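/- arXiv:1007.5400 — 3 statements merged into one kernel-verified Lean document; each statement's English description precedes it below -/
import Mathlib

section
/- If G is a double-critical 8-chromatic graph containing a vertex x of degree 9, then the subgraph of G induced by the neighbourhood of x is isomorphic either to the complete join of the complement of the cycle C_8 with a single vertex, or to the complement of the cycle C_9. -/
/-- A connected graph `G` with chromatic number `k` is *double-critical* if for every
edge `uv` of `G`, deleting both `u` and `v` yields a graph that is `(k-2)`-colourable. -/
def SimpleGraph.DoubleCritical {V : Type*} (G : SimpleGraph V) (k : ℕ) : Prop :=
  G.Connected ∧ G.chromaticNumber = k ∧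
    ∀ u v : V, G.Adj u v →
      (G.induce ({u, v}ᶜ : Set V)).chromaticNumber ≤ (k - 2 : ℕ)

/-- The complete join of two graphs: take disjoint copies of `G` and `H` and add all
edges between them.  (It is the complement of the disjoint sum of the complements.) -/
def SimpleGraph.join {α β : Type*} (G : SimpleGraph α) (H : SimpleGraph β) :
    SimpleGraph (α ⊕ β) :=
  (Gᶜ ⊕g Hᶜ)ᶜ

/-- Combinatorial properties of the complement of the neighbourhood graph. -/
structure CycProp {α : Type*} (H : SimpleGraph α) : Prop where
  deg : ∀ c a b d, H.Adj c a → H.Adj c b → H.Adj c d → a = b ∨ a = d ∨ b = d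
  nxt : ∀ c a, H.Adj c a → ∃ w, H.Adj a w ∧ w ≠ c ∧ ¬ H.Adj c w
  quad : ∀ c a b w, H.Adj c a → H.Adj c b → a ≠ b → H.Adj a w → H.Adj b w → w = c

theorem CycProp.five {α : Type*} {H : SimpleGraph α} (h : CycProp H) {v a1 : α}
    (hv : H.Adj v a1) : ∃ b1 a2 b2, H.Adj v b1 ∧ H.Adj a1 a2 ∧ H.Adj b1 b2 ∧
      [b2, b1, v, a1, a2].Nodup := by
  obtain ⟨a2, h1, h2, h3⟩ := h.nxt v a1 hv
  obtain ⟨b1, h4, h5, h6⟩ := h.nxt a1 v hv.symm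
  obtain ⟨b2, h7, h8, h9⟩ := h.nxt v b1 h4
  have hq := h.quad v a1 b1 a2 hv h4 h5.symm h1
  refine ⟨b1, a2, b2, h4, h1, h7, ?_⟩
  have := hv.ne
  have := h4.ne
  have := h1.ne
  have := h7.ne
  have := h1.symm
  have := h7.symm
  have := h4.symm
  have := hv.symm
  simp only [List.nodup_cons, List.mem_cons, List.not_mem_nil, or_false, not_or, not_false_eq_true, List.nodup_nil, and_true]
  refine ⟨⟨?_, ?_, ?_, ?_⟩, ⟨?_, ?_, ?_⟩, ⟨?_, ?_⟩, ?_⟩ <;> rintro rfl <;> simp_all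

theorem CycProp.iso {α : Type*} [Fintype α] {H : SimpleGraph α} (h : CycProp H)
    (hα : Fintype.card α = 9) (n : ℕ) (c : Fin (n + 5) → α) (hc : Function.Injective c)
    (hadj : ∀ i, H.Adj (c i) (c (i + 1))) :
    Nonempty ((SimpleGraph.cycleGraph (n + 5) ⊕g (⊥ : SimpleGraph (Fin (9 - (n + 5))))) ≃g H) := by
  classical
  have hprev : ∀ i, H.Adj (c i) (c (i - 1)) := fun i => by
    have := hadj (i - 1)
    rw [sub_add_cancel] at this
    exact this.symm
  have hne : ∀ i : Fin (n + 5), i + 1 ≠ i - 1 := by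
    intro i hi
    have h2 : (1 : Fin (n + 5)) + 1 = 0 := by
      have : i + 1 - i + 1 = i - 1 - i + 1 := by rw [hi]
      simpa using this
    have := congrArg Fin.val h2
    rw [Fin.val_add] at this
    have h1 : ((1 : Fin (n + 5)) : ℕ) = 1 := rfl
    rw [h1, Nat.mod_eq_of_lt (by omega)] at this
    simp at this
  have hnb : ∀ i b, H.Adj (c i) b → b = c (i + 1) ∨ b = c (i - 1) := by
    intro i b hb
    have := h.deg _ _ _ _ hb (hadj i) (hprev i)
    have h2 : c (i + 1) ≠ c (i - 1) := fun e => hne i (hc e)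
    tauto
  have hcard : Fintype.card (Set.range c) = n + 5 := by
    rw [Set.card_range_of_injective hc, Fintype.card_fin]
  have hclosed : ∀ a b, H.Adj a b → a ∉ Set.range c → b ∉ Set.range c := by
    rintro a b hab ha ⟨i, rfl⟩
    rcases hnb i a hab.symm with rfl | rfl <;> exact ha ⟨_, rfl⟩
  have hcc : Fintype.card ((Set.range c)ᶜ : Set α) = 9 - (n + 5) := by
    rw [Fintype.card_compl_set, hcard, hα]
  have hiso : ∀ a b, a ∉ Set.range c → ¬ H.Adj a b := by
    intro a b ha hab
    obtain ⟨b1, a2, b2, h1, h2, h3, hnd⟩ := h.five hab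
    have hb := hclosed _ _ hab ha
    have hb1 := hclosed _ _ h1 ha
    have ha2 := hclosed _ _ h2 hb
    have hb2 := hclosed _ _ h3 hb1
    have hle : [b2, b1, a, b, a2].toFinset.card ≤ ((Set.range c)ᶜ : Set α).toFinset.card := by
      apply Finset.card_le_card
      intro z hz
      simp only [List.mem_toFinset, List.mem_cons, List.not_mem_nil, or_false] at hz
      rw [Set.mem_toFinset]
      rcases hz with rfl | rfl | rfl | rfl | rfl <;> assumption
    rw [List.toFinset_card_of_nodup hnd, Set.toFinset_card, hcc] at hle
    simp at hle
    omega
  let e : Fin (n + 5) ⊕ Fin (9 - (n + 5)) ≃ α :=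
    (Equiv.sumCongr (Equiv.ofInjective c hc) (Fintype.equivFinOfCardEq hcc).symm).trans
      (Equiv.Set.sumCompl (Set.range c))
  have el : ∀ i, e (Sum.inl i) = c i := fun i => by simp [e]
  have er : ∀ i, e (Sum.inr i) ∉ Set.range c := fun i => by
    have := ((Fintype.equivFinOfCardEq hcc).symm i).2
    have e1 : e (Sum.inr i) = ((Fintype.equivFinOfCardEq hcc).symm i : α) := by simp [e]
    rw [e1]
    exact this
  refine ⟨⟨e, ?_⟩⟩
  rintro (i | i) (j | j)
  · rw [el, el]
    simp only [SimpleGraph.sum_adj]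
    rw [SimpleGraph.cycleGraph_adj]
    constructor
    · intro hij
      rcases hnb i _ hij with e1 | e1
      · right; rw [hc e1]; simp
      · left; rw [hc e1]; simp
    · rintro (e1 | e1)
      · have : i = j + 1 := by rw [← e1]; simp
        rw [this]; exact (hadj j).symm
      · have : j = i + 1 := by rw [← e1]; simp
        rw [this]; exact (hadj i)
  · simp only [SimpleGraph.sum_adj]
    exact iff_of_false (fun hh => hiso _ _ (er j) hh.symm) (by simp)
  · simp only [SimpleGraph.sum_adj]
    exact iff_of_false (fun hh => hiso _ _ (er i) hh) (by simp)
  · simp only [SimpleGraph.sum_adj]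
    exact iff_of_false (fun hh => hiso _ _ (er i) hh) (by simp)

theorem inj_of_nodup {α : Type*} {n : ℕ} (c : Fin n → α) (h : (List.ofFn c).Nodup) :
    Function.Injective c := List.nodup_ofFn.1 h

theorem CycProp.main {α : Type*} [Fintype α] {H : SimpleGraph α} (h : CycProp H)
    (hα : Fintype.card α = 9) : H = ⊥ ∨ ∃ n ≤ 4,
    Nonempty ((SimpleGraph.cycleGraph (n + 5) ⊕g (⊥ : SimpleGraph (Fin (9 - (n + 5))))) ≃g H) := by
  classical
  by_cases hbot : H = ⊥
  · exact Or.inl hbot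
  right
  obtain ⟨v, a1, hv⟩ := SimpleGraph.ne_bot_iff_exists_adj.1 hbot
  obtain ⟨b1, a2, b2, h1, h2, h3, hnd⟩ := h.five hv
  have hd := h.deg
  have other : ∀ c a, H.Adj c a → ∃ w, H.Adj a w ∧ w ≠ c := fun c a hca => by
    obtain ⟨w, hw, hw', _⟩ := h.nxt c a hca
    exact ⟨w, hw, hw'⟩
  have hs : ∀ a b, H.Adj a b → H.Adj b a := fun a b hab => hab.symm
  have hirr : ∀ a, ¬ H.Adj a a := fun a => H.irrefl
  simp only [List.nodup_cons, List.mem_cons, List.not_mem_nil, or_false, not_or, not_false_eq_true, List.nodup_nil, and_true] at hnd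
  by_cases e5 : H.Adj a2 b2
  · refine ⟨0, by norm_num, h.iso hα 0 ![b2, b1, v, a1, a2] (inj_of_nodup _ ?_) ?_⟩
    · simp [List.ofFn_succ]; grind
    · intro i; fin_cases i <;> simp <;> grind
  obtain ⟨a3, h4, n4⟩ := other _ _ h2
  obtain ⟨b3, h5, n5⟩ := other _ _ h3
  have p3 : a3 ∉ [b2, b1, v, a1, a2] := by
    simp; grind
  have q3 : b3 ∉ [b2, b1, v, a1, a2] := by
    simp; grind
  simp only [List.mem_cons, List.not_mem_nil, or_false, not_or] at p3 q3
  by_cases e6 : a3 = b3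
  · refine ⟨1, by norm_num, h.iso hα 1 ![b2, b1, v, a1, a2, a3] (inj_of_nodup _ ?_) ?_⟩
    · simp [List.ofFn_succ]; grind
    · intro i; fin_cases i <;> simp <;> grind
  by_cases e7 : H.Adj a3 b3
  · refine ⟨2, by norm_num, h.iso hα 2 ![b3, b2, b1, v, a1, a2, a3] (inj_of_nodup _ ?_) ?_⟩
    · simp [List.ofFn_succ]; grind
    · intro i; fin_cases i <;> simp <;> grind
  obtain ⟨a4, h6, n6⟩ := other _ _ h4
  obtain ⟨b4, h7, n7⟩ := other _ _ h5
  have p4 : a4 ∉ [b3, b2, b1, v, a1, a2, a3] := by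
    simp; grind
  have q4 : b4 ∉ [b3, b2, b1, v, a1, a2, a3] := by
    simp; grind
  simp only [List.mem_cons, List.not_mem_nil, or_false, not_or] at p4 q4
  by_cases e8 : a4 = b4
  · refine ⟨3, by norm_num, h.iso hα 3 ![b3, b2, b1, v, a1, a2, a3, a4] (inj_of_nodup _ ?_) ?_⟩
    · simp [List.ofFn_succ]; grind
    · intro i; fin_cases i <;> simp <;> grind
  by_cases e9 : H.Adj a4 b4
  · refine ⟨4, by norm_num, h.iso hα 4 ![b4, b3, b2, b1, v, a1, a2, a3, a4] (inj_of_nodup _ ?_) ?_⟩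
    · simp [List.ofFn_succ]; grind
    · intro i; fin_cases i <;> simp <;> grind
  exfalso
  obtain ⟨a5, h8, n8⟩ := other _ _ h6
  have p5 : a5 ∉ [b4, b3, b2, b1, v, a1, a2, a3, a4] := by
    simp; grind
  have hl : (a5 :: [b4, b3, b2, b1, v, a1, a2, a3, a4]).Nodup := by
    rw [List.nodup_cons]
    refine ⟨p5, ?_⟩
    simp; grind
  have := hl.length_le_card
  rw [hα] at this
  simp at this

open SimpleGraph in
theorem dc_col {V : Type*} {G : SimpleGraph V} (hG : G.DoubleCritical 8) {u v : V}
    (huv : G.Adj u v) : ∃ g : V → Fin 6, ∀ a b, a ≠ u → a ≠ v → b ≠ u → b ≠ v →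
      G.Adj a b → g a ≠ g b := by
  classical
  have h := hG.2.2 u v huv
  rw [SimpleGraph.chromaticNumber_le_iff_colorable] at h
  obtain ⟨C⟩ := h
  refine ⟨fun a => if ha : a ∈ ({u, v}ᶜ : Set V) then C ⟨a, ha⟩ else 0, ?_⟩
  intro a b h1 h2 h3 h4 hab
  have ha : a ∈ ({u, v}ᶜ : Set V) := by simp [h1, h2]
  have hb : b ∈ ({u, v}ᶜ : Set V) := by simp [h3, h4]
  simp only [dif_pos ha, dif_pos hb]
  exact C.valid (by simpa using hab)

theorem dc_not_seven {V : Type*} {G : SimpleGraph V} (hG : G.DoubleCritical 8)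
    (g : V → Fin 7) (hg : ∀ a b, G.Adj a b → g a ≠ g b) : False := by
  have h : G.Colorable 7 := ⟨SimpleGraph.Coloring.mk g (fun {a b} hab => hg a b hab)⟩
  have := h.chromaticNumber_le
  rw [hG.2.1] at this
  exact absurd this (by decide)

theorem dc_triangle {V : Type*} {G : SimpleGraph V} (hG : G.DoubleCritical 8) {u v : V}
    (huv : G.Adj u v) (g : V → Fin 6) (hg : ∀ a b, a ≠ u → a ≠ v → b ≠ u → b ≠ v →
      G.Adj a b → g a ≠ g b) (j : Fin 6) : ∃ w, G.Adj u w ∧ G.Adj v w ∧ g w = j := by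
  classical
  by_contra! hno
  apply dc_not_seven hG (fun a => if a = u then j.castSucc else if a = v then Fin.last 6 else
    if g a = j ∧ G.Adj u a then Fin.last 6 else (g a).castSucc)
  intro a b hab
  have hl : ∀ i : Fin 6, i.castSucc ≠ Fin.last 6 := fun i => (Fin.castSucc_lt_last i).ne
  have hl' : ∀ i : Fin 6, Fin.last 6 ≠ i.castSucc := fun i => (hl i).symm
  have hsy := hab.symm
  have hne := hab.ne
  have hgab := hg a b
  have hna := hno a
  have hnb := hno b
  split_ifs <;> simp_all
  all_goals grind

/-- The complement of the neighbourhood graph has the cycle property. -/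
theorem dc_cyc {V : Type*} [Fintype V] {G : SimpleGraph V} [DecidableRel G.Adj]
    (hG : G.DoubleCritical 8) (x : V) (hx : G.degree x = 9) :
    CycProp (G.induce (G.neighborSet x))ᶜ := by
  classical
  have hadj : ∀ a b : G.neighborSet x, (G.induce (G.neighborSet x))ᶜ.Adj a b ↔
      a ≠ b ∧ ¬ G.Adj a b := fun a b => by simp [SimpleGraph.compl_adj]
  have key : ∀ c : G.neighborSet x, ∀ g : V → Fin 6, (∀ a b, a ≠ x → a ≠ c → b ≠ x → b ≠ c →
      G.Adj a b → g a ≠ g b) → ∀ a : G.neighborSet x, (G.induce (G.neighborSet x))ᶜ.Adj c a →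
      ∃ w : G.neighborSet x, (G.induce (G.neighborSet x))ᶜ.Adj a w ∧ w ≠ c ∧
        ¬ (G.induce (G.neighborSet x))ᶜ.Adj c w ∧ g w = g a := by
    intro c g hg a hca
    obtain ⟨w, h1, h2, h3⟩ := dc_triangle hG c.2 g hg (g a)
    have hca' := (hadj _ _).1 hca
    refine ⟨⟨w, h1⟩, (hadj _ _).2 ⟨?_, ?_⟩, ?_, ?_, h3⟩
    · rintro rfl
      exact hca'.2 h2
    · intro haw
      refine hg a w ?_ ?_ ?_ ?_ haw h3.symm
      · exact (G.ne_of_adj a.2).symm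
      · exact fun e => hca'.1 (Subtype.ext e.symm)
      · exact (G.ne_of_adj h1).symm
      · exact (G.ne_of_adj h2).symm
    · rintro rfl
      exact G.irrefl h2
    · intro hcw
      exact ((hadj _ _).1 hcw).2 h2
  have hdeg : ∀ c a b d, (G.induce (G.neighborSet x))ᶜ.Adj c a →
      (G.induce (G.neighborSet x))ᶜ.Adj c b → (G.induce (G.neighborSet x))ᶜ.Adj c d →
      a = b ∨ a = d ∨ b = d := ?_
  · refine ⟨hdeg, ?_, ?_⟩
    · intro c a hca
      obtain ⟨g, hg⟩ := dc_col hG c.2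
      obtain ⟨w, h1, h2, h3, -⟩ := key c g hg a hca
      exact ⟨w, h1, h2, h3⟩
    · intro c a b w hca hcb hab haw hbw
      by_contra hwc
      obtain ⟨g, hg⟩ := dc_col hG c.2
      obtain ⟨p, p1, p2, p3, p4⟩ := key c g hg a hca
      obtain ⟨q, q1, q2, q3, q4⟩ := key c g hg b hcb
      have e1 : w = p := by
        rcases hdeg a c w p hca.symm haw p1 with e | e | e
        · exact absurd e.symm hwc
        · exact absurd e.symm p2
        · exact e
      have e2 : w = q := by
        rcases hdeg b c w q hcb.symm hbw q1 with e | e | e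
        · exact absurd e.symm hwc
        · exact absurd e.symm q2
        · exact e
      have hG' : G.Adj a b := by
        by_contra hn
        have hH := (hadj a b).2 ⟨hab, hn⟩
        rcases hdeg a c b p hca.symm hH p1 with e | e | e
        · exact hcb.ne e
        · exact p2 e.symm
        · exact p3 (e ▸ hcb)
      refine hg a b ?_ ?_ ?_ ?_ hG' ?_
      · exact (G.ne_of_adj a.2).symm
      · exact fun e => hca.ne (Subtype.ext e.symm)
      · exact (G.ne_of_adj b.2).symm
      · exact fun e => hcb.ne (Subtype.ext e.symm)
      · rw [← p4, ← q4, ← e1, ← e2]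
  · intro c a b d h1 h2 h3
    rw [hadj] at h1 h2 h3
    by_contra! hcon
    obtain ⟨g, hg⟩ := dc_col hG c.2
    have ht := dc_triangle hG c.2 g hg
    choose w hw1 hw2 hw3 using ht
    have hwi : Function.Injective w := fun i j hij => by rw [← hw3 i, ← hw3 j, hij]
    have hsub : (Finset.univ.image w) ∪ {c.1, a.1, b.1, d.1} ⊆ G.neighborFinset x := by
      intro z hz
      rw [SimpleGraph.mem_neighborFinset]
      simp only [Finset.mem_union, Finset.mem_image, Finset.mem_univ, true_and,
        Finset.mem_insert, Finset.mem_singleton] at hz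
      rcases hz with ⟨i, rfl⟩ | rfl | rfl | rfl | rfl
      · exact hw1 i
      · exact c.2
      · exact a.2
      · exact b.2
      · exact d.2
    have hcard := Finset.card_le_card hsub
    rw [SimpleGraph.card_neighborFinset_eq_degree, hx, Finset.card_union_of_disjoint,
      Finset.card_image_of_injective _ hwi] at hcard
    · have h4 : ({c.1, a.1, b.1, d.1} : Finset V).card = 4 := by
        have := h1.1; have := h2.1; have := h3.1
        have i1 := hcon.1; have i2 := hcon.2.1; have i3 := hcon.2.2
        simp only [ne_eq, ← Subtype.coe_inj] at *
        rw [Finset.card_insert_of_notMem, Finset.card_insert_of_notMem, Finset.card_pair] <;> simp [*]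
      rw [h4] at hcard
      simp at hcard
    · rw [Finset.disjoint_left]
      intro z hz hz2
      obtain ⟨i, -, rfl⟩ := Finset.mem_image.1 hz
      have := hw2 i
      simp only [Finset.mem_insert, Finset.mem_singleton] at hz2
      rcases hz2 with e | e | e | e <;> rw [e] at this
      · exact G.irrefl this
      · exact h1.2 this
      · exact h2.2 this
      · exact h3.2 this

theorem compl_iso {α β : Type*} {A : SimpleGraph α} {B : SimpleGraph β} (φ : A ≃g B) :
    Nonempty (Aᶜ ≃g Bᶜ) :=
  ⟨⟨φ.toEquiv, by
    intro a b
    have h1 : B.Adj (φ.toEquiv a) (φ.toEquiv b) ↔ A.Adj a b := φ.map_rel_iff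
    rw [SimpleGraph.compl_adj, SimpleGraph.compl_adj, h1, φ.toEquiv.injective.ne_iff]⟩⟩

theorem no_six (n : ℕ) (hn : n ≤ 2) (g0 : Fin 6) (k : Fin (n + 5) ⊕ Fin (9 - (n + 5)) → Fin 6)
    (h0 : ∀ p, k p ≠ g0)
    (hk : ∀ p q, p ≠ q →
      ¬ (SimpleGraph.cycleGraph (n + 5) ⊕g (⊥ : SimpleGraph (Fin (9 - (n + 5))))).Adj p q →
      k p ≠ k q) : False := by
  classical
  have hri : Function.Injective (fun j => k (Sum.inr j)) := by
    intro i j hij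
    by_contra hne
    exact hk (Sum.inr i) (Sum.inr j) (by simpa using hne) (by simp) hij
  let B : Finset (Fin 6) := insert g0 (Finset.univ.image (fun j => k (Sum.inr j)))
  have hB : B.card = 5 - n := by
    rw [Finset.card_insert_of_notMem, Finset.card_image_of_injective _ hri, Finset.card_fin]
    · omega
    · simp [h0]
  have hBc : Bᶜ.card = n + 1 := by
    rw [Finset.card_compl, hB, Fintype.card_fin]; omega
  have hmaps : ∀ i ∈ (Finset.univ : Finset (Fin (n + 5))), k (Sum.inl i) ∈ Bᶜ := by
    intro i _
    simp only [B, Finset.mem_compl, Finset.mem_insert, Finset.mem_image, Finset.mem_univ,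
      true_and, not_or, not_exists]
    exact ⟨h0 _, fun j => hk _ _ (by simp) (by simp)⟩
  obtain ⟨y, -, hy⟩ := Finset.exists_lt_card_fiber_of_mul_lt_card_of_maps_to (n := 2) hmaps (by
    rw [hBc, Finset.card_fin]; omega)
  obtain ⟨a, b, c, ha, hb, hc, hab, hac, hbc⟩ := Finset.two_lt_card_iff.1 hy
  simp only [Finset.mem_filter, Finset.mem_univ, true_and] at ha hb hc
  have hcyc : ∀ i j : Fin (n + 5), i ≠ j → k (Sum.inl i) = k (Sum.inl j) →
      (SimpleGraph.cycleGraph (n + 5)).Adj i j := by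
    intro i j hij he
    by_contra hna
    exact hk (Sum.inl i) (Sum.inl j) (by simpa using hij) (by simpa using hna) he
  have h1 := hcyc a b hab (ha.trans hb.symm)
  have h2 := hcyc a c hac (ha.trans hc.symm)
  have h3 := hcyc b c hbc (hb.trans hc.symm)
  clear hcyc hbc hac hab hc hb ha hy hmaps hBc hB hri
  rw [SimpleGraph.cycleGraph_adj] at h1 h2 h3
  clear B hk h0 k
  interval_cases n <;> revert a b c <;> decide

/-- If the neighbourhood of `x` can be covered by six independent sets and the vertices outside
the closed neighbourhood are independent, `G` is 7-colourable. -/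
theorem no_cover {V : Type*} {G : SimpleGraph V} (hG : G.DoubleCritical 8) (x : V)
    (hind : ∀ u v, u ∉ G.neighborSet x → v ∉ G.neighborSet x → ¬ G.Adj u v)
    (k : G.neighborSet x → Fin 6)
    (hk : ∀ a b : G.neighborSet x, G.Adj a b → k a ≠ k b) : False := by
  classical
  apply dc_not_seven hG (fun a => if h : a ∈ G.neighborSet x then (k ⟨a, h⟩).succ else 0)
  intro a b hab
  split_ifs with h1 h2 h2
  · intro e
    exact hk ⟨a, h1⟩ ⟨b, h2⟩ hab (Fin.succ_injective _ e)
  · exact Fin.succ_ne_zero _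
  · exact (Fin.succ_ne_zero _).symm
  · exact absurd hab (hind a b h1 h2)

/-- If a double-critical 8-chromatic graph has a vertex `x` of degree 9, then the
neighbourhood graph of `x` is isomorphic to the complete join of the complement of `C₈`
with `K₁`, or to the complement of `C₉`. -/
theorem double_critical_eight_chromatic_degree_nine_neighborhood_structure
    {V : Type*} [Fintype V] (G : SimpleGraph V) [DecidableRel G.Adj]
    (hG : G.DoubleCritical 8) (x : V) (hx : G.degree x = 9) :
    Nonempty
      (G.induce (G.neighborSet x) ≃g
        SimpleGraph.join (SimpleGraph.cycleGraph 8)ᶜ (⊤ : SimpleGraph (Fin 1))) ∨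
    Nonempty (G.induce (G.neighborSet x) ≃g (SimpleGraph.cycleGraph 9)ᶜ) := by
  classical
  have hcardα : Fintype.card (G.neighborSet x) = 9 := by
    rw [SimpleGraph.card_neighborSet_eq_degree, hx]
  rcases (dc_cyc hG x hx).main hcardα with hbot | ⟨n, hn, ⟨φ⟩⟩
  · exfalso
    have hcol : G.Colorable 8 := by
      rw [← SimpleGraph.chromaticNumber_le_iff_colorable, hG.2.1]
    obtain ⟨C⟩ := hcol
    have hinj : Function.Injective (fun a : G.neighborSet x => C a.1) := by
      intro a b hab
      by_contra hne
      have : ¬ (G.induce (G.neighborSet x))ᶜ.Adj a b := by rw [hbot]; simp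
      rw [SimpleGraph.compl_adj] at this
      have h2 : G.Adj a b := by
        by_contra hna
        exact this ⟨hne, by simpa using hna⟩
      exact C.valid h2 hab
    have := Fintype.card_le_of_injective _ hinj
    rw [hcardα, Fintype.card_fin] at this
    omega
  have hφ : ∀ p q, p ≠ q →
      ¬ (SimpleGraph.cycleGraph (n + 5) ⊕g (⊥ : SimpleGraph (Fin (9 - (n + 5))))).Adj p q →
      G.Adj (φ p) (φ q) := by
    intro p q hpq hna
    by_contra hcon
    apply hna
    rw [← φ.map_rel_iff, SimpleGraph.compl_adj]
    exact ⟨fun e => hpq (φ.injective e), by simpa using hcon⟩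
  have hφ' : ∀ a b : G.neighborSet x, G.Adj a b → φ.symm a ≠ φ.symm b ∧
      ¬ (SimpleGraph.cycleGraph (n + 5) ⊕g (⊥ : SimpleGraph (Fin (9 - (n + 5))))).Adj
        (φ.symm a) (φ.symm b) := by
    intro a b hab
    refine ⟨fun e => hab.ne (congrArg Subtype.val (φ.symm.injective e)), fun hcon => ?_⟩
    have h2 := φ.map_rel_iff.2 hcon
    simp only [RelIso.apply_symm_apply] at h2
    rw [SimpleGraph.compl_adj] at h2
    exact h2.2 (by simpa using hab)
  have hxφ : ∀ p, G.Adj x (φ p) := fun p => (φ p).2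
  have hind : n ≤ 2 → ∀ u v, u ∉ G.neighborSet x → v ∉ G.neighborSet x → ¬ G.Adj u v := by
    intro hn2 u v hu hv huv
    obtain ⟨g, hg⟩ := dc_col hG huv
    have hxu : x ≠ u := by
      rintro rfl
      exact hv huv
    have hxv : x ≠ v := by
      rintro rfl
      exact hu huv.symm
    have hpu : ∀ p, (φ p : V) ≠ u := fun p e => hu (e ▸ (φ p).2)
    have hpv : ∀ p, (φ p : V) ≠ v := fun p e => hv (e ▸ (φ p).2)
    exact no_six n hn2 (g x) (fun p => g (φ p))
      (fun p => hg _ _ (hpu p) (hpv p) hxu hxv (hxφ p).symm)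
      (fun p q hpq hna => hg _ _ (hpu p) (hpv p) (hpu q) (hpv q) (hφ p q hpq hna))
  interval_cases n
  · exfalso
    have hedge := hφ (Sum.inl 1) (Sum.inl 3) (by decide) (by
      simp only [SimpleGraph.sum_adj, SimpleGraph.cycleGraph_adj]; decide)
    obtain ⟨g, hg⟩ := dc_col hG hedge
    let t : Fin 6 → Fin 5 ⊕ Fin 4 :=
      ![Sum.inl 0, Sum.inl 2, Sum.inr 0, Sum.inr 1, Sum.inr 2, Sum.inr 3]
    have ht1 : ∀ i, t i ≠ Sum.inl 1 := by decide
    have ht3 : ∀ i, t i ≠ Sum.inl 3 := by decide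
    have hti : ∀ i j, i ≠ j → t i ≠ t j := by decide
    have hta : ∀ i j, ¬ (SimpleGraph.cycleGraph 5 ⊕g (⊥ : SimpleGraph (Fin 4))).Adj (t i) (t j) := by
      intro i j
      fin_cases i <;> fin_cases j <;> simp [t, SimpleGraph.cycleGraph_adj] <;> decide
    have hu : ∀ p q, p ≠ q → (φ p : V) ≠ φ q := fun p q hpq e => hpq (φ.injective (Subtype.ext e))
    have hinj : Function.Injective (fun i => g (φ (t i))) := by
      intro i j hij
      by_contra hne
      exact hg _ _ (hu _ _ (ht1 i)) (hu _ _ (ht3 i)) (hu _ _ (ht1 j)) (hu _ _ (ht3 j))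
        (hφ _ _ (hti i j hne) (hta i j)) hij
    obtain ⟨i, hi⟩ := (Finite.injective_iff_surjective.1 hinj) (g x)
    exact hg _ _ (hu _ _ (ht1 i)) (hu _ _ (ht3 i)) (G.ne_of_adj (hxφ _)) (G.ne_of_adj (hxφ _))
      (hxφ (t i)).symm hi
  · exfalso
    let k : Fin 6 ⊕ Fin 3 → Fin 6 := Sum.elim ![0, 0, 1, 1, 2, 2] ![3, 4, 5]
    refine no_cover hG x (hind (by norm_num)) (fun a => k (φ.symm a)) ?_
    intro a b hab
    obtain ⟨h1, h2⟩ := hφ' a b hab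
    generalize φ.symm a = p at *
    generalize φ.symm b = q at *
    rcases p with i | i <;> rcases q with j | j <;>
      simp only [SimpleGraph.sum_adj, SimpleGraph.cycleGraph_adj] at h2 <;>
      clear * - h1 h2 <;> revert i j <;> decide
  · exfalso
    let k : Fin 7 ⊕ Fin 2 → Fin 6 := Sum.elim ![0, 0, 1, 1, 2, 2, 3] ![4, 5]
    refine no_cover hG x (hind (by norm_num)) (fun a => k (φ.symm a)) ?_
    intro a b hab
    obtain ⟨h1, h2⟩ := hφ' a b hab
    generalize φ.symm a = p at *
    generalize φ.symm b = q at *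
    rcases p with i | i <;> rcases q with j | j <;>
      simp only [SimpleGraph.sum_adj, SimpleGraph.cycleGraph_adj] at h2 <;>
      clear * - h1 h2 <;> revert i j <;> decide
  · left
    obtain ⟨ψ⟩ := compl_iso φ.symm
    rw [compl_compl] at ψ
    unfold SimpleGraph.join
    rw [compl_compl, compl_top]
    exact ⟨ψ⟩
  · right
    obtain ⟨ψ⟩ := compl_iso φ.symm
    rw [compl_compl] at ψ
    have θ : (SimpleGraph.cycleGraph 9 ⊕g (⊥ : SimpleGraph (Fin 0))) ≃g SimpleGraph.cycleGraph 9 :=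
      ⟨Equiv.sumEmpty _ _, by
        rintro (i | i) (j | j)
        · simp
        · exact j.elim0
        · exact i.elim0
        · exact i.elim0⟩
    obtain ⟨θ'⟩ := compl_iso θ
    exact ⟨ψ.trans θ'⟩
end

section
/- Every double-critical 8-chromatic graph with minimum degree 9 contains a complete minor on 8 vertices (a K_8 minor). -/
/-- `G.HasMinor H` means `H` is a minor of `G`, witnessed by nonempty pairwise disjoint
branch sets inducing connected subgraphs, with edges of `G` between branch sets
corresponding to adjacent vertices of `H`. -/
def SimpleGraph.HasMinor {V W : Type*} (G : SimpleGraph V) (H : SimpleGraph W) : Prop :=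
  ∃ B : W → Set V,
    (∀ w, (B w).Nonempty) ∧
    (Pairwise fun w₁ w₂ => Disjoint (B w₁) (B w₂)) ∧
    (∀ w, (G.induce (B w)).Connected) ∧
    (∀ w₁ w₂, H.Adj w₁ w₂ → ∃ v₁ ∈ B w₁, ∃ v₂ ∈ B w₂, G.Adj v₁ v₂)

namespace DC8

variable {V : Type*}

/-- Turning chromatic bounds into total colour functions. -/
lemma edge_col (G : SimpleGraph V) (hG : G.DoubleCritical 8) {x y : V} (h : G.Adj x y) :
    ∃ c : V → Fin 6, ∀ a b, a ≠ x → a ≠ y → b ≠ x → b ≠ y → G.Adj a b → c a ≠ c b := by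
  classical
  have h1 := hG.2.2 x y h
  have h2 : (G.induce ({x, y}ᶜ : Set V)).Colorable 6 :=
    SimpleGraph.chromaticNumber_le_iff_colorable.1 (by simpa using h1)
  obtain ⟨c⟩ := h2
  refine ⟨fun v => if hv : v ∈ ({x, y}ᶜ : Set V) then c ⟨v, hv⟩ else 0, ?_⟩
  intro a b ha hb ha' hb' hab
  have h3 : a ∈ ({x, y}ᶜ : Set V) := by simp [ha, hb]
  have h4 : b ∈ ({x, y}ᶜ : Set V) := by simp [ha', hb']
  simp only [h3, h4, dif_pos]
  exact c.valid (by simpa using hab)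

lemma not_col (G : SimpleGraph V) (hG : G.DoubleCritical 8) (c : V → Option (Fin 6))
    (hc : ∀ a b, G.Adj a b → c a ≠ c b) : False := by
  have h1 : G.Colorable 7 := by
    have := (SimpleGraph.Coloring.mk c (fun {a b} h => hc a b h)).colorable
    simpa using this
  have h2 := SimpleGraph.chromaticNumber_le_iff_colorable.2 h1
  rw [hG.2.1] at h2
  exact absurd (by exact_mod_cast h2 : (8 : ℕ) ≤ 7) (by norm_num)

/-- Every colour occurs on a common neighbour. -/
lemma common (G : SimpleGraph V) (hG : G.DoubleCritical 8) {x y : V} (h : G.Adj x y)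
    (c : V → Fin 6)
    (hc : ∀ a b, a ≠ x → a ≠ y → b ≠ x → b ≠ y → G.Adj a b → c a ≠ c b) (i : Fin 6) :
    ∃ d, G.Adj x d ∧ G.Adj y d ∧ c d = i := by
  classical
  by_contra hne
  push Not at hne
  apply not_col G hG (fun v => if v = x then some i else if v = y then none else
    if c v = i ∧ G.Adj x v then none else some (c v))
  intro a b hab
  have hba := hab.symm
  have hxy := h.ne
  have hne' := hab.ne
  have h1 := hc a b
  have h2 := hne a
  have h3 := hne b
  grind

/-- Kempe chain connecting two neighbours of `x`. -/
lemma kempe (G : SimpleGraph V) (hG : G.DoubleCritical 8) {x a b : V}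
    (c : V → Option (Fin 6)) (hc : ∀ u v, u ≠ x → v ≠ x → G.Adj u v → c u ≠ c v)
    (ha : G.Adj x a) (hb : G.Adj x b) (hab : c a ≠ c b)
    (hun : ∀ n, G.Adj x n → n ≠ a → n ≠ b → c n ≠ c a ∧ c n ≠ c b) :
    ∃ K : Set V, a ∈ K ∧ (G.induce K).Connected ∧ (∃ k ∈ K, G.Adj k b) ∧
      x ∉ K ∧ ∀ n, G.Adj x n → n ≠ a → n ∉ K := by
  classical
  let R : V → V → Prop := fun u w => G.Adj u w ∧ (w ≠ x ∧ w ≠ b ∧ (c w = c a ∨ c w = c b))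
  let K : Set V := {v | Relation.ReflTransGen R a v}
  have hK : ∀ v ∈ K, v ≠ x ∧ v ≠ b ∧ (c v = c a ∨ c v = c b) := by
    intro v hv
    rcases Relation.ReflTransGen.cases_tail hv with h | ⟨u, _, h⟩
    · subst h
      exact ⟨ha.ne', fun h => hab (h ▸ rfl), Or.inl rfl⟩
    · exact h.2
  have hstep : ∀ u w, u ∈ K → G.Adj u w → w ≠ x → w ≠ b → (c w = c a ∨ c w = c b) → w ∈ K :=
    fun u w hu h1 h2 h3 h4 => Relation.ReflTransGen.tail hu ⟨h1, h2, h3, h4⟩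
  have haK : a ∈ K := Relation.ReflTransGen.refl
  have hreach : ∀ v (h : Relation.ReflTransGen R a v),
      (G.induce K).Reachable ⟨a, haK⟩ ⟨v, h⟩ := by
    intro v h
    induction h with
    | refl => exact SimpleGraph.Reachable.refl _
    | tail h1 h2 ih =>
      refine ih.trans (SimpleGraph.Adj.reachable ?_)
      simpa using h2.1
  refine ⟨K, haK, ?_, ?_, fun h => (hK x h).1 rfl, ?_⟩
  · have : Nonempty K := ⟨⟨a, haK⟩⟩
    exact ⟨fun u v => (hreach u.1 u.2).symm.trans (hreach v.1 v.2)⟩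
  · by_contra hne
    push Not at hne
    apply not_col G hG (fun v => if v = x then c a else if v ∈ K then
      (if c v = c a then c b else c a) else c v)
    intro u v huv
    have hvu := huv.symm
    have hn := huv.ne
    have e1 := hc u v
    have e2 := hstep u v
    have e3 := hstep v u
    have e4 := hK u
    have e5 := hK v
    have e6 := hun u
    have e7 := hun v
    have e8 := hne u
    have e9 := hne v
    have e10 : x ∉ K := fun h => (hK x h).1 rfl
    have e11 : b ∉ K := fun h => (hK b h).2.1 rfl
    have e12 : a ∈ K := haK
    generalize hKK : (fun w => w ∈ K) = P
    have hP : ∀ w, (w ∈ K) = P w := fun w => by rw [← hKK]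
    simp only [hP] at *
    clear hreach haK hK hstep hKK hP hne hun hc
    by_cases i1 : u = a <;> by_cases i2 : u = b <;> by_cases i3 : v = a <;>
      by_cases i4 : v = b <;> grind
  · intro n hn hna hnK
    have := hK n hnK
    have := hun n hn hna this.2.1
    tauto

/-- Non-adjacency within the neighbourhood of `x`. -/
def NA (G : SimpleGraph V) (x a b : V) : Prop := G.Adj x a ∧ G.Adj x b ∧ a ≠ b ∧ ¬ G.Adj a b

lemma NA.symm {G : SimpleGraph V} {x a b : V} (h : NA G x a b) : NA G x b a :=
  ⟨h.2.1, h.1, h.2.2.1.symm, fun h' => h.2.2.2 h'.symm⟩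

lemma shared (G : SimpleGraph V) (hG : G.DoubleCritical 8) {x y z : V} (h : NA G x y z)
    (c : V → Fin 6)
    (hc : ∀ a b, a ≠ x → a ≠ z → b ≠ x → b ≠ z → G.Adj a b → c a ≠ c b) :
    ∃ d, NA G x y d ∧ G.Adj z d ∧ c d = c y := by
  obtain ⟨d, h1, h2, h3⟩ := common G hG h.2.1 c hc (c y)
  refine ⟨d, ⟨h.1, h1, ?_, ?_⟩, h2, h3⟩
  · rintro rfl
    exact h.2.2.2 h2.symm
  · intro h4
    exact hc y d h.1.ne' h.2.2.1 h1.ne' h2.ne' h4 h3.symm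

lemma exists_second (G : SimpleGraph V) (hG : G.DoubleCritical 8) {x y z : V}
    (h : NA G x y z) : ∃ d, d ≠ z ∧ NA G x y d ∧ ¬ NA G x z d := by
  obtain ⟨c, hc⟩ := edge_col G hG h.2.1
  obtain ⟨d, h1, h2, -⟩ := shared G hG h c hc
  exact ⟨d, h2.ne', h1, fun h' => h'.2.2.2 h2⟩

/-- If `deg x = 9`, then two non-neighbours force at most six common neighbours, rainbow. -/
lemma two (G : SimpleGraph V) [Fintype V] [DecidableEq V] [DecidableRel G.Adj]
    (hG : G.DoubleCritical 8) {x y p q : V} (hx : (G.neighborFinset x).card = 9)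
    (hp : NA G x y p) (hq : NA G x y q) (hpq : p ≠ q) :
    (∀ r, NA G x y r → r = p ∨ r = q) ∧
    (∀ c : V → Fin 6,
      (∀ a b, a ≠ x → a ≠ y → b ≠ x → b ≠ y → G.Adj a b → c a ≠ c b) →
      ∀ d e, G.Adj x d → G.Adj y d → G.Adj x e → G.Adj y e → c d = c e → d = e) := by
  classical
  set C := (G.neighborFinset x).filter (fun d => G.Adj y d) with hC
  have himg : ∀ c : V → Fin 6,
      (∀ a b, a ≠ x → a ≠ y → b ≠ x → b ≠ y → G.Adj a b → c a ≠ c b) →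
      (C.image c).card = 6 := by
    intro c hc
    have : C.image c = Finset.univ := by
      ext i
      simp only [Finset.mem_image, Finset.mem_univ, iff_true]
      obtain ⟨d, h1, h2, h3⟩ := common G hG hp.1 c hc i
      exact ⟨d, by simp [hC, h1, h2], h3⟩
    simp [this]
  have hge : 6 ≤ C.card := by
    obtain ⟨c, hc⟩ := edge_col G hG hp.1
    rw [← himg c hc]
    exact Finset.card_image_le
  have hle : ∀ T : Finset V, (∀ t ∈ T, NA G x y t) → C.card + 1 + T.card ≤ 9 := by
    intro T hT
    have hd : Disjoint C T := by
      rw [Finset.disjoint_left]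
      intro t h1 h2
      exact (hT t h2).2.2.2 (by simpa [hC] using (Finset.mem_filter.1 h1).2)
    have hy : y ∉ C ∪ T := by
      intro h
      rcases Finset.mem_union.1 h with h | h
      · exact G.loopless.irrefl y (Finset.mem_filter.1 h).2
      · exact (hT y h).2.2.1 rfl
    have hs : insert y (C ∪ T) ⊆ G.neighborFinset x := by
      intro t ht
      rw [SimpleGraph.mem_neighborFinset]
      rcases Finset.mem_insert.1 ht with rfl | ht
      · exact hp.1
      rcases Finset.mem_union.1 ht with h | h
      · simpa using (Finset.mem_filter.1 h).1
      · exact (hT t h).2.1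
    have := Finset.card_le_card hs
    rw [Finset.card_insert_of_notMem hy, Finset.card_union_of_disjoint hd, hx] at this
    omega
  constructor
  · intro r hr
    by_contra hne
    push Not at hne
    have h3 : ({p, q, r} : Finset V).card = 3 := by
      rw [Finset.card_eq_three]
      exact ⟨p, q, r, hpq, hne.1.symm, hne.2.symm, rfl⟩
    have := hle {p, q, r} (by
      intro t ht
      simp only [Finset.mem_insert, Finset.mem_singleton] at ht
      rcases ht with rfl | rfl | rfl <;> assumption)
    omega
  · intro c hc d e h1 h2 h3 h4 h5
    have hl := hle {p, q} (by
      intro t ht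
      simp only [Finset.mem_insert, Finset.mem_singleton] at ht
      rcases ht with rfl | rfl <;> assumption)
    rw [Finset.card_pair hpq] at hl
    have h6 : (C.image c).card = C.card := by
      rw [himg c hc]; omega
    exact Finset.injOn_of_card_image_eq h6 (by simp [hC, h1, h2]) (by simp [hC, h3, h4]) h5

lemma no_C4 (G : SimpleGraph V) (hG : G.DoubleCritical 8) {x : V}
    (hfull : ∀ y p q r, NA G x y p → NA G x y q → p ≠ q → NA G x y r → r = p ∨ r = q)
    {a b c d : V}
    (h1 : NA G x a b) (h2 : NA G x b c) (h3 : NA G x c d) (h4 : NA G x d a)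
    (hac : a ≠ c) (hbd : b ≠ d) : False := by
  obtain ⟨k, hk⟩ := edge_col G hG h2.1
  obtain ⟨e, e1, e2, e3⟩ := shared G hG h1 k hk
  obtain ⟨f, f1, f2, f3⟩ := shared G hG h2.symm k hk
  have he : e = d := (hfull a b d e h1 h4.symm hbd e1).resolve_left e2.ne'
  have hf : f = d := (hfull c b d f h2.symm h3 hbd f1).resolve_left f2.ne'
  subst he
  subst hf
  have hadj : G.Adj a c := by
    by_contra hn
    have h5 : NA G x a c := ⟨h1.1, h2.2.1, hac, hn⟩
    rcases hfull a b f c h1 h4.symm hbd h5 with h | h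
    · exact h2.2.2.1 h.symm
    · exact h3.2.2.1 h
  exact hk a c h1.1.ne' h1.2.2.1 h2.2.1.ne' h2.2.2.1.symm hadj (e3.symm.trans f3)

/-- Cyclic adjacency of indices. -/
def cyc (m i j : ℕ) : Prop :=
  i < m ∧ j < m ∧ (i + 1 = j ∨ j + 1 = i ∨ (i = 0 ∧ j + 1 = m) ∨ (j = 0 ∧ i + 1 = m))

instance (m i j : ℕ) : Decidable (cyc m i j) := by unfold cyc; infer_instance

section Comb

variable [DecidableEq V] (N : Finset V) (H : V → V → Prop)

lemma exists_cycle (hN : ∀ a b, H a b → a ∈ N) (hsymm : ∀ a b, H a b → H b a)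
    (hirr : ∀ a, ¬ H a a)
    (hfull : ∀ y p q r, H y p → H y q → p ≠ q → H y r → r = p ∨ r = q)
    (hsec : ∀ y z, H y z → ∃ d, d ≠ z ∧ H y d ∧ ¬ H z d) (k : ℕ) :
    ∀ (n : ℕ) (v : ℕ → V), N.card < n + k → 2 ≤ n →
    (∀ i < n, ∀ j < n, v i = v j → i = j) → (∀ i, i + 1 < n → H (v i) (v (i + 1))) →
    ∃ (m : ℕ) (w : ℕ → V), w 0 = v 0 ∧ 3 ≤ m ∧
      (∀ i < m, ∀ j < m, w i = w j → i = j) ∧ (∀ i, i + 1 < m → H (w i) (w (i + 1))) ∧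
      H (w (m - 1)) (w 0) := by
  induction k with
  | zero =>
    intro n v hn h2 hinj hch
    exfalso
    have h1 : (Finset.range n).image v ⊆ N := by
      intro t ht
      obtain ⟨i, hi, rfl⟩ := Finset.mem_image.1 ht
      rw [Finset.mem_range] at hi
      by_cases h : i + 1 < n
      · exact hN _ _ (hch i h)
      · have := hch (i - 1) (by omega)
        rw [show i - 1 + 1 = i by omega] at this
        exact hN _ _ (hsymm _ _ this)
    have h3 := Finset.card_le_card h1
    rw [Finset.card_image_of_injOn, Finset.card_range] at h3
    · omega
    · intro i hi j hj h
      exact hinj i (by simpa using hi) j (by simpa using hj) h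
  | succ k ih =>
    intro n v hn h2 hinj hch
    have hlast := hch (n - 2) (by omega)
    rw [show n - 2 + 1 = n - 1 by omega] at hlast
    obtain ⟨d, d1, d2, d3⟩ := hsec (v (n - 1)) (v (n - 2)) (hsymm _ _ hlast)
    by_cases hd : ∃ j < n, d = v j
    · obtain ⟨j, hj, rfl⟩ := hd
      have hj1 : j ≠ n - 1 := by rintro rfl; exact hirr _ d2
      have hj2 : j ≠ n - 2 := by rintro rfl; exact d1 rfl
      rcases Nat.eq_zero_or_pos j with rfl | hpos
      · exact ⟨n, v, rfl, by omega, hinj, hch, d2⟩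
      · exfalso
        have e1 := hch (j - 1) (by omega)
        rw [show j - 1 + 1 = j by omega] at e1
        have e2 := hch j (by omega)
        have e3 : v (j - 1) ≠ v (j + 1) := by
          intro h
          have := hinj _ (by omega) _ (by omega) h
          omega
        rcases hfull (v j) _ _ _ (hsymm _ _ e1) e2 e3 (hsymm _ _ d2) with h | h
        · have := hinj _ (by omega) _ (by omega) h
          omega
        · have := hinj _ (by omega) _ (by omega) h
          omega
    · push Not at hd
      obtain ⟨m, w, hw, hrest⟩ := ih (n + 1) (fun i => if i < n then v i else d)
        (by omega) (by omega) (by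
          intro i hi j hj h
          have a1 := hd i
          have a2 := hd j
          have a3 := hinj i
          have a4 := hinj j
          grind) (by
          intro i hi
          rcases Nat.lt_or_ge (i + 1) n with h | h
          · simp only [h, show i < n by omega, if_true]
            exact hch i h
          · have : i = n - 1 := by omega
            subst this
            simp only [show n - 1 < n by omega, show ¬ (n - 1 + 1 < n) by omega,
              if_true, if_false]
            exact d2)
      refine ⟨m, w, ?_, hrest⟩
      rw [hw]
      simp [show 0 < n by omega]

lemma cycle5 (hN : ∀ a b, H a b → a ∈ N) (hsymm : ∀ a b, H a b → H b a)
    (hirr : ∀ a, ¬ H a a)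
    (hfull : ∀ y p q r, H y p → H y q → p ≠ q → H y r → r = p ∨ r = q)
    (hsec : ∀ y z, H y z → ∃ d, d ≠ z ∧ H y d ∧ ¬ H z d)
    (h4 : ∀ a b c d, H a b → H b c → H c d → H d a → a ≠ c → b ≠ d → False)
    {a b : V} (hab : H a b) :
    ∃ (m : ℕ) (w : ℕ → V), w 0 = a ∧ 5 ≤ m ∧ (∀ i < m, w i ∈ N) ∧
      (∀ i < m, ∀ j < m, w i = w j → i = j) ∧ (∀ i, i + 1 < m → H (w i) (w (i + 1))) ∧
      (∀ i < m, ∀ d, H (w i) d → ∃ j < m, d = w j ∧ cyc m i j) := by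
  obtain ⟨m, w, w0, hm, hinj, hch, hcl⟩ := exists_cycle N H hN hsymm hirr hfull hsec
    N.card 2 (fun i => if i = 0 then a else b) (by omega) le_rfl (by
      intro i hi j hj h
      have : a ≠ b := by rintro rfl; exact hirr _ hab
      interval_cases i <;> interval_cases j <;> simp_all) (by
      intro i hi
      have : i = 0 := by omega
      subst this
      simpa using hab)
  have hclos : ∀ i < m, ∀ d, H (w i) d → ∃ j < m, d = w j ∧ cyc m i j := by
    intro i hi d hd
    have hne : ∀ p < m, ∀ q < m, p ≠ q → w p ≠ w q := fun p hp q hq h h' => h (hinj p hp q hq h')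
    by_cases h0 : i = 0
    · subst h0
      rcases hfull _ _ _ _ (hch 0 (by omega)) (hsymm _ _ hcl)
        (hne _ (by omega) _ (by omega) (by omega)) hd with h | h
      · exact ⟨_, by omega, h, by unfold cyc; omega⟩
      · exact ⟨_, by omega, h, by unfold cyc; omega⟩
    · have e1 := hch (i - 1) (by omega)
      rw [show i - 1 + 1 = i by omega] at e1
      by_cases h1 : i = m - 1
      · subst h1
        rcases hfull _ _ _ _ (hsymm _ _ e1) hcl
          (hne _ (by omega) _ (by omega) (by omega)) hd with h | h
        · exact ⟨_, by omega, h, by unfold cyc; omega⟩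
        · exact ⟨_, by omega, h, by unfold cyc; omega⟩
      · rcases hfull _ _ _ _ (hsymm _ _ e1) (hch i (by omega))
          (hne _ (by omega) _ (by omega) (by omega)) hd with h | h
        · exact ⟨_, by omega, h, by unfold cyc; omega⟩
        · exact ⟨_, by omega, h, by unfold cyc; omega⟩
  refine ⟨m, w, by simpa using w0, ?_, ?_, hinj, hch, hclos⟩
  · by_contra hlt
    have h34 : m = 3 ∨ m = 4 := by omega
    rcases h34 with rfl | rfl
    · have e1 := hch 0 (by omega)
      have e2 := hch 1 (by omega)
      obtain ⟨d, d1, d2, d3⟩ := hsec _ _ e1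
      have e3 : w 1 ≠ w 2 := fun h => by have := hinj 1 (by omega) 2 (by omega) h; omega
      rcases hfull _ _ _ _ e1 (hsymm _ _ hcl) e3 d2 with h | h
      · exact d1 h
      · subst h
        exact d3 e2
    · exact h4 _ _ _ _ (hch 0 (by omega)) (hch 1 (by omega)) (hch 2 (by omega)) hcl
        (fun h => by have := hinj 0 (by omega) 2 (by omega) h; omega)
        (fun h => by have := hinj 1 (by omega) 3 (by omega) h; omega)
  · intro i hi
    by_cases h : i + 1 < m
    · exact hN _ _ (hch i h)
    · have := hch (i - 1) (by omega)
      rw [show i - 1 + 1 = i by omega] at this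
      exact hN _ _ (hsymm _ _ this)

/-- The complement of the neighbourhood is a cycle plus isolated vertices. -/
lemma nbhd_shape (hcard : N.card = 9) (hN : ∀ a b, H a b → a ∈ N)
    (hsymm : ∀ a b, H a b → H b a) (hirr : ∀ a, ¬ H a a)
    (hfull : ∀ y p q r, H y p → H y q → p ≠ q → H y r → r = p ∨ r = q)
    (hsec : ∀ y z, H y z → ∃ d, d ≠ z ∧ H y d ∧ ¬ H z d)
    (h4 : ∀ a b c d, H a b → H b c → H c d → H d a → a ≠ c → b ≠ d → False) :
    ∃ (m : ℕ) (f : Fin 9 ≃ N), 5 ≤ m ∧ m ≤ 9 ∧ (∀ i j, H (f i) (f j) → cyc m i j) ∧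
      (m = 9 → H (f 3) (f 2) ∧ H (f 3) (f 4)) := by
  classical
  by_cases hE : ∃ a b, H a b
  swap
  · push Not at hE
    refine ⟨5, (N.equivFinOfCardEq hcard).symm, le_rfl, by omega, ?_, by omega⟩
    intro i j h
    exact absurd h (hE _ _)
  obtain ⟨a, b, hab⟩ := hE
  obtain ⟨m, w, -, hm, hwN, hinj, hch, hcl⟩ := cycle5 N H hN hsymm hirr hfull hsec h4 hab
  have hinjOn : ∀ (m : ℕ) (w : ℕ → V), (∀ i < m, ∀ j < m, w i = w j → i = j) →
      ((Finset.range m).image w).card = m := by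
    intro m w h
    rw [Finset.card_image_of_injOn, Finset.card_range]
    intro i hi j hj h'
    exact h i (by simpa using hi) j (by simpa using hj) h'
  have hsub : ∀ (m : ℕ) (w : ℕ → V), (∀ i < m, w i ∈ N) → (Finset.range m).image w ⊆ N := by
    intro m w h t ht
    obtain ⟨i, hi, rfl⟩ := Finset.mem_image.1 ht
    exact h i (Finset.mem_range.1 hi)
  have hm9 : m ≤ 9 := by
    rw [← hinjOn m w hinj, ← hcard]
    exact Finset.card_le_card (hsub m w hwN)
  -- every other vertex is isolated
  have hiso : ∀ u d, H u d → ∃ i < m, u = w i := by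
    intro u d hud
    by_contra hne
    push Not at hne
    obtain ⟨m', w', w0, hm', hwN', hinj', hch', -⟩ :=
      cycle5 N H hN hsymm hirr hfull hsec h4 hud
    have hout : ∀ i, i < m' → ∀ j < m, w' i ≠ w j := by
      intro i
      induction i with
      | zero => intro _ j hj; rw [w0]; exact hne j hj
      | succ i ih =>
        intro hi j hj h
        have := hch' i hi
        rw [h] at this
        obtain ⟨l, hl, hl', -⟩ := hcl j hj _ (hsymm _ _ this)
        exact ih (by omega) l hl hl'
    have hd : Disjoint ((Finset.range m').image w') ((Finset.range m).image w) := by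
      rw [Finset.disjoint_left]
      intro t h1 h2
      obtain ⟨i, hi, rfl⟩ := Finset.mem_image.1 h1
      obtain ⟨j, hj, h⟩ := Finset.mem_image.1 h2
      exact hout i (Finset.mem_range.1 hi) j (Finset.mem_range.1 hj) h.symm
    have := Finset.card_le_card (Finset.union_subset (hsub m' w' hwN') (hsub m w hwN))
    rw [Finset.card_union_of_disjoint hd, hinjOn m w hinj, hinjOn m' w' hinj'] at this
    omega
  obtain ⟨f, hf⟩ := Finset.exists_equiv_extend_of_card_eq (α := Fin 9) (t := N)
    (by simp [hcard]) (s := Finset.univ.filter (fun i : Fin 9 => (i : ℕ) < m))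
    (f := fun i => w i) (by
      intro t ht
      obtain ⟨i, hi, rfl⟩ := Finset.mem_image.1 ht
      exact hwN i (by simpa using hi)) (by
      intro i hi j hj h
      exact Fin.ext (hinj i (by simpa using hi) j (by simpa using hj) h))
  have hf' : ∀ i : Fin 9, (i : ℕ) < m → (f i : V) = w i := fun i hi => hf i (by simpa using hi)
  have hidx : ∀ (i : Fin 9) (k : ℕ), k < m → (f i : V) = w k → (i : ℕ) = k := by
    intro i k hk h
    have h1 := hf' ⟨k, by omega⟩ hk
    have h2 : f i = f ⟨k, by omega⟩ := Subtype.ext (h.trans h1.symm)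
    have := f.injective h2
    rw [this]
  refine ⟨m, f, hm, hm9, ?_, ?_⟩
  · intro i j h
    obtain ⟨k, hk, hik⟩ := hiso _ _ h
    rw [hik] at h
    obtain ⟨l, hl, hjl, hc⟩ := hcl k hk _ h
    rw [hidx i k hk hik, hidx j l hl hjl]
    exact hc
  · rintro rfl
    rw [hf' 3 (by decide), hf' 2 (by decide), hf' 4 (by decide)]
    exact ⟨hsymm _ _ (hch 2 (by omega)), hch 3 (by omega)⟩

end Comb

/-- Two connected sets joined by an edge have connected union. -/
lemma conn_union (G : SimpleGraph V) {s t : Set V} (hs : (G.induce s).Connected)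
    (ht : (G.induce t).Connected) (h : ∃ a ∈ s, ∃ b ∈ t, G.Adj a b) :
    (G.induce (s ∪ t)).Connected := by
  obtain ⟨a, ha, b, hb, hab⟩ := h
  have e1 : ∀ u (hu : u ∈ s), (G.induce (s ∪ t)).Reachable ⟨u, Or.inl hu⟩ ⟨a, Or.inl ha⟩ := by
    intro u hu
    exact (hs.preconnected ⟨u, hu⟩ ⟨a, ha⟩).map (G.induceHomOfLE Set.subset_union_left).toHom
  have e2 : ∀ u (hu : u ∈ t), (G.induce (s ∪ t)).Reachable ⟨u, Or.inr hu⟩ ⟨b, Or.inr hb⟩ := by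
    intro u hu
    exact (ht.preconnected ⟨u, hu⟩ ⟨b, hb⟩).map (G.induceHomOfLE Set.subset_union_right).toHom
  have e3 : (G.induce (s ∪ t)).Reachable ⟨b, Or.inr hb⟩ ⟨a, Or.inl ha⟩ :=
    SimpleGraph.Adj.reachable (by simpa using hab.symm)
  have e4 : ∀ u : ↥(s ∪ t), (G.induce (s ∪ t)).Reachable u ⟨a, Or.inl ha⟩ := by
    rintro ⟨u, hu | hu⟩
    · exact e1 u hu
    · exact (e2 u hu).trans e3
  have : Nonempty ↥(s ∪ t) := ⟨⟨a, Or.inl ha⟩⟩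
  exact ⟨fun u v => (e4 u).trans (e4 v).symm⟩

/-- Touching relation between blobs. -/
def T (G : SimpleGraph V) (s t : Set V) : Prop := ∃ a ∈ s, ∃ b ∈ t, G.Adj a b

lemma T.symm {G : SimpleGraph V} {s t : Set V} (h : T G s t) : T G t s := by
  obtain ⟨a, ha, b, hb, h⟩ := h
  exact ⟨b, hb, a, ha, h.symm⟩

/-- Merging blobs along a labelling `l`, where each class has a centre `r` touching the
other members of its class. -/
lemma merge (G : SimpleGraph V) (e : Fin 10 → Set V)
    (hconn : ∀ i, (G.induce (e i)).Connected)
    (hdisj : ∀ i j, i ≠ j → Disjoint (e i) (e j))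
    (R : Fin 10 → Fin 10 → Prop) (hR : ∀ i j, R i j → T G (e i) (e j))
    (l : Fin 10 → Fin 8) (r : Fin 8 → Fin 10) (hr : ∀ k, l (r k) = k)
    (hcen : ∀ i, i = r (l i) ∨ R (r (l i)) i)
    (hadj : ∀ k k', k ≠ k' → ∃ i j, l i = k ∧ l j = k' ∧ R i j) :
    G.HasMinor (⊤ : SimpleGraph (Fin 8)) := by
  have hne : ∀ i, (e i).Nonempty := fun i => by
    obtain ⟨⟨v, hv⟩⟩ := (hconn i).nonempty
    exact ⟨v, hv⟩
  refine ⟨fun k => {v | ∃ i, l i = k ∧ v ∈ e i}, ?_, ?_, ?_, ?_⟩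
  · intro k
    obtain ⟨v, hv⟩ := hne (r k)
    exact ⟨v, r k, hr k, hv⟩
  · intro k k' hk
    rw [Set.disjoint_left]
    rintro v ⟨i, hi, hv⟩ ⟨j, hj, hv'⟩
    have hij : i ≠ j := by
      rintro rfl
      exact hk (hi.symm.trans hj)
    exact Set.disjoint_left.1 (hdisj i j hij) hv hv'
  · intro k
    obtain ⟨a, ha⟩ := hne (r k)
    refine SimpleGraph.induce_connected_of_patches a ⟨r k, hr k, ha⟩ ?_
    rintro v ⟨i, hi, hv⟩
    subst hi
    refine ⟨e (r (l i)) ∪ e i, ?_, Or.inl ha, Or.inr hv, ?_⟩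
    · rintro w (hw | hw)
      · exact ⟨_, hr _, hw⟩
      · exact ⟨_, rfl, hw⟩
    · rcases hcen i with h | h
      · have h1 : (G.induce (e (r (l i)) ∪ e i)).Connected := by
          rw [← h, Set.union_self]
          exact hconn i
        exact h1.preconnected _ _
      · exact (conn_union G (hconn _) (hconn _) (hR _ _ h)).preconnected _ _
  · intro k k' hk
    obtain ⟨i, j, hi, hj, h⟩ := hadj k k' hk
    obtain ⟨a, ha, b, hb, hab⟩ := hR i j h
    exact ⟨a, ⟨i, hi, ha⟩, b, ⟨j, hj, hb⟩, hab⟩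

/-- Guaranteed touching relation for the ten blobs (index `9` is the apex). -/
def Rm (m : ℕ) (i j : Fin 10) : Prop :=
  i ≠ j ∧ (i = 9 ∨ j = 9 ∨ ¬ cyc m i j ∨ (m = 9 ∧ i = 7 ∧ j = 8) ∨ (m = 9 ∧ i = 8 ∧ j = 7))

instance (m : ℕ) (i j : Fin 10) : Decidable (Rm m i j) := by unfold Rm; infer_instance

lemma finish (G : SimpleGraph V) (e : Fin 10 → Set V)
    (hconn : ∀ i, (G.induce (e i)).Connected)
    (hdisj : ∀ i j, i ≠ j → Disjoint (e i) (e j)) (m : ℕ) (h5 : 5 ≤ m) (h9 : m ≤ 9)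
    (hR : ∀ i j, Rm m i j → T G (e i) (e j)) : G.HasMinor (⊤ : SimpleGraph (Fin 8)) := by
  have h : m = 5 ∨ m = 6 ∨ m = 7 ∨ m = 8 ∨ m = 9 := by omega
  rcases h with rfl | rfl | rfl | rfl | rfl
  · exact merge G e hconn hdisj _ hR ![0, 1, 0, 0, 2, 3, 4, 5, 6, 7] ![0, 1, 4, 5, 6, 7, 8, 9]
      (by decide) (by decide) (by decide)
  · exact merge G e hconn hdisj _ hR ![0, 1, 0, 2, 0, 3, 4, 5, 6, 7] ![0, 1, 3, 5, 6, 7, 8, 9]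
      (by decide) (by decide) (by decide)
  all_goals
    exact merge G e hconn hdisj _ hR ![0, 2, 1, 3, 0, 4, 1, 5, 6, 7] ![0, 2, 1, 3, 5, 7, 8, 9]
      (by decide) (by decide) (by decide)

lemma conn_singleton (G : SimpleGraph V) (v : V) : (G.induce {v}).Connected := by
  have : Nonempty ({v} : Set V) := ⟨⟨v, rfl⟩⟩
  refine ⟨fun a b => ?_⟩
  rw [Subsingleton.elim a b]

end DC8

open DC8

/-- Every double-critical 8-chromatic graph with minimum degree 9 contains a `K₈` minor. -/
theorem double_critical_eight_chromatic_minDegree_nine_hasMinor_K8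
    {V : Type*} [Fintype V] (G : SimpleGraph V) [DecidableRel G.Adj]
    (hG : G.DoubleCritical 8) (hδ : G.minDegree = 9) :
    G.HasMinor (⊤ : SimpleGraph (Fin 8)) := by
  classical
  have hne : Nonempty V := hG.1.nonempty
  obtain ⟨x, hx⟩ := G.exists_minimal_degree_vertex
  have hx9 : (G.neighborFinset x).card = 9 := by
    rw [SimpleGraph.card_neighborFinset_eq_degree, ← hx, hδ]
  have hfull : ∀ y p q r, NA G x y p → NA G x y q → p ≠ q → NA G x y r → r = p ∨ r = q :=
    fun y p q r hp hq hpq hr => (two G hG hx9 hp hq hpq).1 r hr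
  obtain ⟨m, f, h5, h9, hcyc, hm9⟩ := nbhd_shape (G.neighborFinset x) (NA G x) hx9
    (fun a b h => by simpa using h.1) (fun a b h => h.symm) (fun a h => h.2.2.1 rfl) hfull
    (fun y z h => exists_second G hG h)
    (fun a b c d h1 h2 h3 h4 hac hbd => no_C4 G hG hfull h1 h2 h3 h4 hac hbd)
  have hfx : ∀ i, G.Adj x (f i) := fun i =>
    (SimpleGraph.mem_neighborFinset _ _ _).1 (f i).2
  have hfinj : ∀ i j, (f i : V) = f j → i = j := fun i j h => f.injective (Subtype.ext h)
  have hfsurj : ∀ n, G.Adj x n → ∃ i, n = f i := fun n hn =>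
    ⟨f.symm ⟨n, by simpa using hn⟩, by simp⟩
  have hadj : ∀ i j : Fin 9, i ≠ j → ¬ cyc m i j → G.Adj (f i) (f j) := by
    intro i j hij hc
    by_contra hn
    exact hc (hcyc i j ⟨hfx i, hfx j, fun h => hij (hfinj i j h), hn⟩)
  -- the blob at `f 7`
  obtain ⟨K, hK1, hK2, hK3, hK4, hK5⟩ : ∃ K : Set V, (f 7 : V) ∈ K ∧ (G.induce K).Connected ∧
      (m = 9 → ∃ k ∈ K, G.Adj k (f 8)) ∧ x ∉ K ∧
      ∀ n, G.Adj x n → n ≠ (f 7 : V) → n ∉ K := by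
    by_cases hm : m = 9
    · obtain ⟨q2, q4⟩ := hm9 hm
      have h24 : (f 2 : V) ≠ f 4 := fun h => absurd (hfinj _ _ h) (by decide)
      obtain ⟨t1, t2⟩ := two G hG hx9 q2 q4 h24
      obtain ⟨c, hc⟩ := edge_col G hG (hfx 3)
      have hcinj := t2 c hc
      subst hm
      have hcne : ∀ i j : Fin 9, i ≠ 3 → j ≠ 3 → i ≠ j → ¬ cyc 9 i j → c (f i) ≠ c (f j) :=
        fun i j hi hj hij h => hc _ _ (hfx i).ne' (fun h => hi (hfinj _ _ h)) (hfx j).ne'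
          (fun h => hj (hfinj _ _ h)) (hadj i j hij h)
      have hcne' : ∀ i j : Fin 9, ¬ cyc 9 3 i → ¬ cyc 9 3 j → i ≠ 3 → j ≠ 3 → i ≠ j →
          c (f i) ≠ c (f j) := fun i j h1 h2 h3 h4 hij h =>
        hij (hfinj _ _ (hcinj _ _ (hfx i) (hadj 3 i h3.symm h1) (hfx j) (hadj 3 j h4.symm h2) h))
      have hcall : ∀ i j : Fin 9, (j = 7 ∨ j = 8) → i ≠ 3 → i ≠ j → c (f i) ≠ c (f j) := by
        intro i j hj h3 hij
        have hd : (¬ cyc 9 3 i ∧ ¬ cyc 9 3 j ∧ j ≠ 3) ∨ (¬ cyc 9 i j ∧ j ≠ 3) := by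
          revert i j; decide
        rcases hd with ⟨a1, a2, a3⟩ | ⟨a1, a2⟩
        · exact hcne' i j a1 a2 h3 a3 hij
        · exact hcne i j h3 a2 hij a1
      have h73 : (f 7 : V) ≠ f 3 := fun h => absurd (hfinj _ _ h) (by decide)
      have h83 : (f 8 : V) ≠ f 3 := fun h => absurd (hfinj _ _ h) (by decide)
      obtain ⟨K, k1, k2, k3, k4, k5⟩ := kempe G hG
        (fun v => if v = (f 3 : V) then none else some (c v)) (x := x) (a := f 7) (b := f 8)
        (by
          intro u v hu hv huv
          have := hc u v hu
          have := huv.ne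
          grind) (hfx 7) (hfx 8) (by
          simp only [h73, h83, if_false]
          intro h
          exact hcall 7 8 (by decide) (by decide) (by decide) (Option.some.inj h)) (by
          intro n hn hn7 hn8
          obtain ⟨i, rfl⟩ := hfsurj n hn
          by_cases hi : i = 3
          · subst hi; simp [h73, h83]
          · have hi' : (f i : V) ≠ f 3 := fun h => hi (hfinj _ _ h)
            simp only [h73, h83, hi', if_false]
            exact ⟨fun h => hcall i 7 (by decide) hi (fun h => hn7 (h ▸ rfl)) (Option.some.inj h),
              fun h => hcall i 8 (by decide) hi (fun h => hn8 (h ▸ rfl)) (Option.some.inj h)⟩)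
      exact ⟨K, k1, k2, fun _ => k3, k4, k5⟩
    · exact ⟨{(f 7 : V)}, rfl, conn_singleton G _, fun h => absurd h hm, (hfx 7).ne,
        fun n _ h => h⟩
  -- the ten blobs
  let p : Fin 10 → V := fun i => if h : (i : ℕ) < 9 then f ⟨i, h⟩ else x
  have hp9 : p 9 = x := rfl
  have hpx : ∀ i, i ≠ 9 → G.Adj x (p i) := by
    intro i hi
    have : (i : ℕ) < 9 := by omega
    simp only [p, this, dif_pos]
    exact hfx _
  have hpinj : ∀ i j, p i = p j → i = j := by
    intro i j h
    by_cases hi : i = 9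
    · by_cases hj : j = 9
      · rw [hi, hj]
      · subst hi
        exact absurd (h ▸ hpx j hj) (by rw [hp9]; exact G.loopless.irrefl x)
    · by_cases hj : j = 9
      · subst hj
        exact absurd (h ▸ hpx i hi) (by rw [hp9]; exact G.loopless.irrefl x)
      · have h1 : (i : ℕ) < 9 := by omega
        have h2 : (j : ℕ) < 9 := by omega
        simp only [p, h1, h2, dif_pos] at h
        have := hfinj _ _ h
        simp only [Fin.mk.injEq] at this
        exact Fin.ext this
  let e : Fin 10 → Set V := fun i => if i = 7 then K else {p i}
  have hpe : ∀ i, p i ∈ e i := by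
    intro i
    by_cases hi : i = 7
    · subst hi; exact hK1
    · simp [e, hi]
  have hKp : ∀ i, i ≠ 7 → p i ∉ K := by
    intro i hi
    by_cases h : i = 9
    · subst h; exact hK4
    · exact hK5 _ (hpx i h) (fun h' => hi (hpinj i 7 h'))
  refine finish G e ?_ ?_ m h5 h9 ?_
  · intro i
    by_cases hi : i = 7
    · rw [show e i = K from if_pos hi]; exact hK2
    · rw [show e i = {p i} from if_neg hi]; exact conn_singleton G _
  · intro i j hij
    by_cases hi : i = 7
    · subst hi
      simp only [e, if_true, hij.symm, if_false]
      exact Set.disjoint_singleton_right.2 (hKp j hij.symm)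
    · by_cases hj : j = 7
      · subst hj
        simp only [e, if_true, hij, if_false]
        exact Set.disjoint_singleton_left.2 (hKp i hij)
      · simp only [e, hi, hj, if_false]
        exact Set.disjoint_singleton.2 (fun h => hij (hpinj i j h))
  · rintro i j ⟨hij, h⟩
    by_cases hi : i = 9
    · subst hi
      exact ⟨_, hpe 9, _, hpe j, hpx j hij.symm⟩
    by_cases hj : j = 9
    · subst hj
      exact ⟨_, hpe i, _, hpe 9, (hpx i hij).symm⟩
    rcases h with h | h | h | ⟨h1, rfl, rfl⟩ | ⟨h1, rfl, rfl⟩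
    · exact absurd h hi
    · exact absurd h hj
    · refine ⟨_, hpe i, _, hpe j, ?_⟩
      have h1 : (i : ℕ) < 9 := by omega
      have h2 : (j : ℕ) < 9 := by omega
      simp only [p, h1, h2, dif_pos]
      exact hadj _ _ (fun h' => hij (Fin.ext (by simpa using h'))) h
    · obtain ⟨k, hk, hk'⟩ := hK3 h1
      exact ⟨k, hk, _, hpe 8, hk'⟩
    · obtain ⟨k, hk, hk'⟩ := hK3 h1
      exact ⟨_, hpe 8, k, hk, hk'.symm⟩
end

section
/- Suppose G is a double-critical 8-chromatic graph with minimum degree 10 that contains a vertex x of degree 10 such that the subgraph G_x induced by the neighbourhood of x contains at least one vertex whose degree in G_x equals 9. Then G contains a minor isomorphic to the complete graph on 8 vertices with one edge removed. -/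
/-- The complete graph on 8 vertices with one edge removed. -/
def K8minus : SimpleGraph (Fin 8) :=
  (⊤ : SimpleGraph (Fin 8)).deleteEdges {s((0 : Fin 8), (1 : Fin 8))}

namespace K8aux

/-- Candidate models of `K₆⁻` on nine labelled vertices; the first two parts are the pair which
need not be adjacent. -/
def models : List (List (List ℕ)) := [
  [[7], [8], [0], [1, 5], [2, 6], [3, 4]],
  [[1, 6], [4], [0], [2, 7], [3, 5], [8]],
  [[7], [8], [0], [1, 6], [2, 4], [3, 5]],
  [[7], [8], [0], [1, 6], [2, 5], [3, 4]],
  [[0, 5], [3], [1, 7], [2], [4, 6], [8]],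
  [[3], [7], [0, 5], [1, 6], [2, 8], [4]],
  [[7], [8], [0, 4], [1, 5], [2], [3, 6]],
  [[4, 6], [8], [0, 7], [1], [2], [3, 5]],
  [[0], [3], [1, 6], [2, 7], [4, 5], [8]],
  [[1], [4], [0, 8], [2], [3, 6], [5, 7]],
  [[3], [8], [0, 6], [1], [2, 5], [4, 7]],
  [[7], [8], [0, 4], [1, 5], [2, 6], [3]],
  [[3, 6], [7], [0], [1, 5], [2, 8], [4]],
  [[1], [3], [0, 5], [2, 7], [4, 6], [8]],
  [[7], [8], [0, 4, 5], [1, 6], [2], [3]],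
  [[1, 7], [5], [0], [2, 8], [3, 6], [4]],
  [[2], [5], [0], [1, 7], [3, 8], [4, 6]],
  [[0, 5], [2], [1, 7], [3, 6], [4], [8]],
  [[3], [8], [0, 5], [1, 7], [2], [4, 6]],
  [[6], [7], [0, 4], [1], [2, 5], [3, 8]],
  [[0], [2], [1, 6], [3, 7], [4, 5], [8]],
  [[4, 6], [8], [0, 7], [1], [2, 5], [3]],
  [[1, 6], [4], [0, 5], [2], [3, 7], [8]],
  [[3, 5], [8], [0], [1, 6], [2, 7], [4]],
  [[1], [4], [0, 7], [2, 8], [3], [5, 6]],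
  [[2, 6], [4], [0], [1, 5], [3, 7], [8]],
  [[4, 6], [8], [0, 5], [1, 7], [2], [3]],
  [[0, 5], [3], [1, 6], [2, 7], [4], [8]],
  [[1], [4, 5], [0, 6], [2, 7], [3], [8]],
  [[2], [6], [0, 8], [1, 7], [3], [4, 5]],
  [[3], [4, 5], [0, 6], [1, 7], [2], [8]],
  [[3], [8], [0, 5], [1, 6], [2], [4, 7]],
  [[6], [7], [0, 5], [1, 8], [2, 4], [3]],
  [[2], [4], [0, 6], [1, 7], [3, 5], [8]],
  [[2, 8], [5], [0, 7], [1, 6], [3], [4]],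
  [[2, 7], [5], [0], [1, 6], [3, 8], [4]],
  [[7], [8], [0], [1, 4], [2, 6], [3, 5]],
  [[4], [8], [0, 6], [1, 7], [2], [3, 5]],
  [[4, 7], [8], [0, 6], [1], [2, 5], [3]],
  [[1, 6], [4], [0, 5, 7], [2], [3], [8]],
  [[1, 6], [5], [0, 7], [2, 8], [3], [4]],
  [[3, 6], [8], [0], [1, 5], [2, 7], [4]],
  [[2, 6], [3], [0, 5], [1, 7], [4], [8]],
  [[1], [5], [0, 6], [2, 7], [3], [4, 8]],
  [[2], [6], [0, 8], [1], [3, 5], [4, 7]],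
  [[1], [4], [0, 7], [2, 5], [3, 6], [8]],
  [[2, 5], [6], [0, 7], [1, 8], [3], [4]],
  [[0, 8], [3], [1, 2, 7], [4], [5], [6]],
  [[0, 6], [2], [1, 5, 7], [3], [4], [8]],
  [[2, 7], [6], [0], [1, 8], [3], [4, 5]],
  [[2], [4, 5], [0, 7], [1, 6], [3], [8]],
  [[3], [4, 5], [0, 7], [1, 6], [2], [8]],
  [[0, 6], [2], [1], [3, 5], [4, 7], [8]],
  [[4, 7], [8], [0, 5], [1, 6], [2], [3]],
  [[2, 8], [7], [0], [1, 6], [3, 5], [4]],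
  [[0, 7], [2], [1, 8], [3, 6], [4], [5]],
  [[3], [7], [0, 8], [1, 5], [2], [4, 6]],
  [[3], [7], [0, 8], [1, 6], [2], [4, 5]],
  [[6], [7], [0, 4], [1, 8], [2, 5], [3]],
  [[0], [2], [1, 6], [3, 8], [4], [5, 7]],
  [[4], [8], [0, 6], [1, 5], [2, 7], [3]],
  [[7], [8], [0, 5], [1, 6], [2], [3, 4]],
  [[3, 6], [7], [0, 5], [1, 8], [2], [4]]]

/-- Bit test through kernel-accelerated operations. -/
def bit (M k : ℕ) : Bool := Nat.beq (Nat.land 1 (Nat.shiftRight M k)) 1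

/-- Code of an unordered pair. -/
def code (u v : ℕ) : ℕ := bif Nat.blt u v then 9 * u + v else 9 * v + u

/-- Bit mask of all pairs formed by `u` and a member of the list. -/
def line (u : ℕ) : List ℕ → ℕ
  | [] => 0
  | v :: Q => Nat.lor (2 ^ code u v) (line u Q)

/-- Bit mask of all pairs between two lists. -/
def cell : List ℕ → List ℕ → ℕ
  | [], _ => 0
  | u :: P, Q => Nat.lor (line u Q) (cell P Q)

/-- Bit mask of all pairs inside a list. -/
def clq : List ℕ → ℕ
  | [] => 0
  | u :: P => Nat.lor (line u P) (clq P)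

/-- Bit mask of all pairs inside some part. -/
def clqs : List (List ℕ) → ℕ
  | [] => 0
  | P :: R => Nat.lor (clq P) (clqs R)

/-- Bit masks for all pairs of parts. -/
def cells : List (List ℕ) → List ℕ
  | [] => []
  | P :: R => R.map (cell P) ++ cells R

/-- The masks belonging to a model. -/
def toMasks : List (List ℕ) → ℕ × List ℕ
  | A :: B :: R => (clqs (A :: B :: R), R.map (cell A) ++ (R.map (cell B) ++ cells R))
  | _ => (0, [])

/-- The masks of all the models. -/
def masks : List (ℕ × List ℕ) := [
  (2164277248, [128, 4503599627436032, 2305843009247248384, 8813272891392, 256, 9007199254872064, 4611686018494496768, 17626545782784, 34, 68, 24, 2251799822108672, 2203318235136, 4406642737152]),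
  (4328554496, [66, 2305843009230538752, 2251808403640320, 4611686018427518976, 16, 8796097216512, 2201170739200, 17592186044416, 132, 40, 256, 4503616817725440, 2361183241434889715712, 9007233614479360]),
  (4299194368, [128, 2305843009213759488, 8796126576640, 4503616807239680, 256, 4611686018427518976, 17592253153280, 9007233614479360, 66, 20, 40, 4398063298560, 2251808403640320, 2201181224960]),
  (2155905024, [128, 2305843009213759488, 4503599660924928, 8813272891392, 256, 4611686018427518976, 9007199321849856, 17626545782784, 66, 36, 24, 2251799830480896, 4406636457984, 2203324514304]),
  (4398046576672, [4503599627387010, 8388612, 2253998836940880, 9007199254741248, 17179873280, 2097152, 10737418240, 34359738368, 33556480, 2305851805306757120, 2361183241434822737920, 20971520, 67108864, 4611703610613432320]),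
  (67141664, [4294967304, 8589938688, 34361835520, 2147483648, 4503599627370624, 2305843009213759488, 2361183241434856161280, 8796093022208, 2251799813701698, 9007199263129860, 2199023255568, 4611686018444298240, 4398046519296, 17592190238720]),
  (8589950992, [8796093022336, 4503599627436032, 33554432, 2305843026393563136, 17592186044672, 9007199254872064, 67108864, 4611686052787126272, 2199023263778, 4194308, 4400193994824, 8390656, 2251804108689408, 18874368]),
  (4402341478528, [2305851805306716240, 40960, 20971520, 2254009574359040, 2361183241434822607104, 131072, 67108864, 9007233614479360, 65538, 33554436, 4503616807239720, 2048, 20480, 10485760]),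
  (2199056842752, [66, 132, 48, 256, 8589938688, 17181966336, 6442450944, 34359738368, 2305843009230538752, 2256197860220928, 4611686018427518976, 4512395732975616, 2361183241434889715712, 9024791440785408]),
  (4503608217305344, [131074, 2048, 36864, 81920, 17592186044432, 4194304, 4400193994752, 10995116277760, 67108868, 4611686052787126344, 2361192248634077348000, 18874368, 41943040, 2308094830502215680]),
  (8796101410880, [8589934600, 4096, 4297064448, 19327352832, 4611686018427388160, 131072, 9007199321849856, 2361183259027008651264, 32770, 2251799830462500, 2305847407260205200, 18432, 73728, 4505798688374784]),
  (16793616, [8796093022336, 4503599627436032, 2305843009247248384, 17179869184, 17592186044672, 9007199254872064, 4611686018494496768, 34359738368, 2199023263778, 4398050705476, 2147483656, 2251799822108672, 4294971392, 8592031744]),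
  (8657059840, [72, 2251804108689408, 4611686052806000640, 4400193994752, 128, 4503599627436032, 2361183241434856161280, 8796093022208, 34, 260, 16, 9007199263262720, 2199023263744, 17592190238720]),
  (4398080065568, [16386, 67584, 40960, 131072, 4294967304, 17181966336, 10737418240, 34359738368, 4503599635759236, 2253998836940880, 9007199254741248, 2305851805327687680, 2361183241434889715712, 4611703610613432320]),
  (2199023288368, [4512395720392832, 2305843009213759488, 33554432, 17179869184, 9024791440785664, 4611686018427518976, 67108864, 34359738368, 2256197860220994, 12582916, 6442450952, 16779264, 8589938688, 2097152]),
  (8657108992, [130, 2361183241434856294400, 2305843026393600000, 8796093030400, 32, 9007199263129600, 2251804108652544, 2199023255552, 260, 72, 16, 4611686052806000640, 17592190238720, 4400193994752]),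
  (4432406315008, [4, 33556480, 69206016, 20971520, 32, 4503599627386880, 9007203549708288, 2253998836940800, 130, 264, 80, 2361183241452002611200, 2305851805306757120, 4611703621350850560]),
  (8590000160, [4503599627387010, 2251804108652616, 2199023255568, 9007199254741248, 33556480, 18874368, 4194304, 67108864, 2305843026393600000, 8796093030400, 2361183241434822737920, 4400193994752, 4611686052787126272, 17592186044416]),
  (4398046576672, [4294967304, 17179873280, 2097152, 10737418240, 9007199254741248, 2361183241434822737920, 67108864, 4611703610613432320, 4503599627387010, 8388612, 2253998836940880, 33556480, 2305851805306757120, 20971520]),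
  (34368126992, [4398046511168, 32768, 2251799830462464, 4611686027017322496, 8796093022336, 65536, 4503599660924928, 2361183241452002476032, 8194, 2199027449892, 17594333528328, 18432, 135168, 9007203618914304]),
  (2216203157504, [66, 136, 48, 256, 16779264, 35651584, 12582912, 67108864, 2305843017803698176, 2256197860220928, 4611686018427518976, 4512402162843648, 2361183241469182345216, 9024791440785408]),
  (4398054899840, [2305851805306716240, 40960, 2253998857912320, 10737418240, 2361183241434822607104, 131072, 9007199321849856, 34359738368, 65538, 4503599660924964, 17179869192, 18432, 4096, 4297064448]),
  (17179901984, [2251799813701698, 16779264, 2305843017803698176, 4611686018427518976, 2199023255568, 4194304, 8798240505856, 17592186044416, 8388612, 4503603922337928, 9007199254741248, 35651584, 67108864, 2361183241469182345216]),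
  (4328554496, [40, 2251808403640320, 4503616817725440, 2201170739200, 256, 4611686018427518976, 2361183241434889715712, 17592186044416, 66, 132, 16, 2305843009230538752, 4398046519296, 8796097216512]),
  (2251799880794240, [65538, 133120, 4096, 49152, 8796093022224, 17592190238720, 2147483648, 6597069766656, 2361183241434856161540, 17179869192, 2310346608841064544, 34361835520, 4620693217707294720, 12884901888]),
  (17196662784, [68, 2251799822108672, 2305843017839280128, 4611686018494496768, 16, 2199023263744, 8798240505856, 17592186044416, 34, 136, 256, 4503603922407424, 9007199254872064, 2361183241469182345216]),
  (4398046576672, [2253998836940880, 2305851805306757120, 20971520, 10737418240, 9007199254741248, 2361183241434822737920, 67108864, 34359738368, 4503599627387010, 8388612, 4294967304, 33556480, 17179873280, 2097152]),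
  (33587232, [2251799813701698, 4503599635759236, 2199023255568, 9007199254741248, 8589938688, 17181966336, 2147483648, 34359738368, 2305843009230538752, 4398046519296, 4611686018427518976, 8796097216512, 2361183241434889715712, 17592186044416]),
  (2199056810048, [32770, 67584, 4096, 131072, 2256197860196400, 4512395732975616, 6442450944, 9024791440785408, 2305843009230471300, 8589934600, 4611686018427388160, 17181966336, 2361183241434889715712, 34359738368]),
  (2199023321344, [67108868, 33556480, 2097152, 12582912, 4611686018427387968, 2305843009213726720, 8589934592, 2256197860196352, 2361183241434822738050, 34359738376, 9024791440785456, 17179873280, 4512395720417280, 6442450944]),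
  (2199023321152, [8589934600, 17179873280, 2097152, 34359738368, 2256197860196400, 4512395720417280, 12582912, 9024791440785408, 2305843009213726850, 16777220, 4611686018427388160, 33556480, 2361183241434822737920, 67108864]),
  (8796093055008, [4294967304, 8589938688, 2097152, 19327352832, 9007199254741248, 4611686018427518976, 67108864, 2361183259027008651264, 2251799813701698, 8388612, 4505798650626192, 16779264, 2305847407260278784, 37748736]),
  (4325408, [2251799813685312, 4611686018427420672, 4398063288320, 8589934592, 4503599627370624, 2361183241434822672384, 8796126576640, 17179869184, 9007199254757634, 2199031644180, 4294967304, 17592253163520, 34359742464, 2149580800]),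
  (4295032896, [16777220, 33556480, 10485760, 67108864, 4398046511120, 8796093030400, 2201170739200, 17592186044416, 2305843009213726850, 2251808403619880, 4611686018427388160, 4503616807260160, 2361183241434822737920, 9007233614479360]),
  (67141760, [2361183241434856161540, 4611686018444298240, 34361835520, 17592190238720, 4503599627370528, 2251799813701632, 4294967296, 2199023255552, 2305843009213759554, 17179869192, 8796093022224, 8589938688, 4398046519296, 2147483648]),
  (34393325568, [132, 2305843009230538752, 2361183241452071682048, 8796097216512, 32, 2251799813701632, 9007203549708288, 2199023255552, 66, 264, 16, 4611686027017457664, 4398046519296, 17594333528064]),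
  (4311752704, [128, 8796093087744, 2305843009247248384, 4503616807239680, 256, 17592186175488, 4611686018494496768, 9007233614479360, 18, 68, 40, 4398050740224, 2201170759680, 2251808414105600]),
  (4295032896, [4398046511120, 8796093030400, 4194304, 2201170739200, 4611686018427388160, 2361183241434822737920, 67108864, 9007233614479360, 2305843009213726850, 16777220, 2251808403619880, 33556480, 4503616807260160, 10485760]),
  (8796101410880, [2305847407260205200, 73728, 4505798688374784, 19327352832, 4611686018427388160, 131072, 9007199321849856, 34359738368, 32770, 2251799830462500, 8589934600, 18432, 4096, 4297064448]),
  (4503599627403424, [2308094809027461186, 16779264, 8589938688, 4611686018427518976, 10995116277776, 4194304, 2147483648, 17592186044416, 41943044, 21474836488, 2361192248634077348096, 2097152, 67108864, 34359738368]),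
  (67141760, [2305843009213759554, 4611686018444298240, 8589938688, 4398046519296, 4503599627370528, 9007199263129600, 4294967296, 2199023255552, 2361183241434856161540, 17179869192, 8796093022224, 34361835520, 17592190238720, 2147483648]),
  (8623505408, [72, 2251804108689408, 2305843026412437504, 4400193994752, 256, 9007199254872064, 2361183241434889715712, 17592186044416, 34, 132, 16, 4503599635826688, 2199023263744, 8796097216512]),
  (16842784, [2251799822073924, 2305843009247283200, 4398050705408, 4611686018494496768, 4294967304, 17179873280, 2147483648, 34359738368, 4503599627387010, 2199023255568, 9007199254741248, 8796093030400, 2361183241434822737920, 17592186044416]),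
  (17592219598912, [32770, 67584, 4096, 139264, 2251799813685280, 4503599635759104, 4294967296, 9009398277996544, 2305843009230471300, 8589934600, 4611690416473899280, 17181966336, 2361183250230986932224, 36507222016]),
  (8800387989760, [67108868, 2048, 10485760, 37748736, 4611686018427387968, 32768, 2251808403619840, 2305847407260205056, 131074, 9007233614479400, 2361183259027008651408, 20480, 73728, 4505817977978880]),
  (8598323328, [65538, 18432, 36864, 131072, 8796093022224, 2199027449856, 4400193994752, 17592186044416, 4503599660924964, 2305843026393563208, 2361183241434822607104, 2251804127526912, 9007199321849856, 4611686052787126272]),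
  (8519808, [4503599660924964, 9007199321868288, 4297064448, 2199027449856, 2305843009213694016, 4611686018427420672, 8589934592, 4398046511104, 2361183241434822672642, 17179869192, 8796093022224, 34359742464, 17592186052608, 2147483648]),
  (33622272, [2361183241434889846918, 17592186044432, 9007199254741024, 4611686018427387968, 17181970432, 2147483648, 4294967296, 8589934592, 8796097224704, 4503599635775488, 2305843009230503936, 2199023255552, 4398046511104, 2251799813685248]),
  (4503599627452480, [2308094809027412130, 8589934600, 4398046511120, 4611686018427388160, 41945088, 2097152, 4194304, 67108864, 21474840576, 10995116285952, 2361192248634077478912, 2147483648, 34359738368, 17592186044416]),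
  (2199056941056, [132, 2361183241434889783296, 17181966336, 4512395732975616, 64, 4611686018427420672, 8589934592, 2256197860196352, 258, 8, 48, 34359742464, 9024791440809984, 6442450944]),
  (2199023288448, [33554436, 16779264, 2097152, 67108864, 4512395720392752, 2256197860220928, 6442450944, 9024791440785408, 2305843009213759554, 17179869192, 2361183241434822607104, 8589938688, 4611686018427518976, 34359738368]),
  (2199023288448, [17179869192, 8589938688, 2097152, 34359738368, 4512395720392752, 2256197860220928, 12582912, 9024791440785408, 2305843009213759554, 33554436, 2361183241434822607104, 16779264, 4611686018427518976, 67108864]),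
  (8800387989568, [32770, 2251808403619880, 2305847407260205200, 4611686018427388160, 2048, 10485760, 37748736, 67108864, 20480, 73728, 131072, 4505817977978880, 9007233614479360, 2361183259027008651264]),
  (8796093055008, [4505798650626192, 2305847407260278784, 37748736, 19327352832, 9007199254741248, 4611686018427518976, 67108864, 34359738368, 2251799813701698, 8388612, 4294967304, 16779264, 8589938688, 2097152]),
  (4362108928, [260, 4611686018444298240, 9007233624965120, 17592190238720, 128, 2305843009213759488, 4503616807239680, 8796093022208, 66, 40, 16, 2251808403640320, 4398046519296, 2201170739200]),
  (8590065792, [2361183241434822672642, 2305843026393563208, 8796093022224, 4503599627370528, 67110912, 18874368, 4194304, 8388608, 4611686052787163136, 17592186052608, 9007199254757376, 4400193994752, 2251804108652544, 2199023255552]),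
  (4398046527744, [34359738376, 4294971392, 2097152, 10737418240, 2361183241434822606976, 4503599627436032, 33554432, 2305851805306716160, 9007199254872098, 67108868, 4611703610613432400, 8390656, 2253998836981760, 20971520]),
  (2199023288576, [34359738376, 8589938688, 2097152, 6442450944, 2361183241434822606976, 2305843009213759488, 33554432, 4512395720392704, 4611686018427519042, 67108868, 9024791440785456, 16779264, 2256197860220928, 12582912]),
  (8519696, [4398046511168, 4611686018427420672, 2251799830462464, 8589934592, 8796093022336, 2361183241434822672384, 4503599660924928, 17179869184, 17592186052866, 2199027449892, 2147483656, 9007199321868288, 34359742464, 4297064448]),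
  (4503633987141632, [66, 264, 16, 160, 16779264, 69206016, 4194304, 41943040, 4611686027017457664, 4398046519296, 2308094809027461120, 17594333528064, 2361192248655552184320, 10995116277760]),
  (33570880, [4398046511120, 2199023263744, 8796097216512, 2147483648, 4611686018427388160, 9007199254872064, 2361183241434889715712, 34359738368, 2251799813718050, 2305843009230471300, 8589934600, 4503599635826688, 4294971392, 17181966336]),
  (2147516448, [4503599627370624, 2305843009213759488, 33554432, 8813272891392, 9007199254741248, 4611686018427518976, 67108864, 17626545782784, 2251799813701698, 8388612, 2203318222872, 16779264, 4406636457984, 6291456]),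
  (8590065696, [2251804108652616, 4611686052787163136, 18874368, 4400193994752, 4503599627370624, 2361183241434822672384, 33554432, 8796093022208, 9007199254757634, 8388612, 2199023255568, 67110912, 17592186052608, 4194304])]

theorem masks_eq : masks = models.map toMasks := by decide +kernel

/-- Test of a model against the mask `U` of pairs which are not known to be adjacent. -/
def check (U : ℕ) (m : ℕ × List ℕ) : Bool :=
  Nat.beq (Nat.land m.1 U) 0 && m.2.all fun q => !(Nat.beq (Nat.land q U) q)

/-- Recorded non-adjacency. -/
def non (M a c : ℕ) : Bool :=
  bif Nat.blt a c then bit M (Nat.add (Nat.mul 9 a) c)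
  else Nat.blt c a && bit M (Nat.add (Nat.mul 9 c) a)

/-- The vertex `a` has more than three recorded non-neighbours. -/
def ovf (M a : ℕ) : Bool := Nat.ble 4 ((List.range 9).filter (non M a)).length

/-- Look-up tables (modulus, packed six-bit entries) guessing which model applies; they only
speed up the search. -/
def tables : List (ℕ × ℕ) := [
  (889, 7858018934485545439080260401378132560581022102832241377715899753105106825116985763354213706248936039881924690685577191588709701047316443584343708743407438734798472624212690205070058020677541942879000546663883925215420068758950151013464648523916850719572948472378098306669508412505888713601268849307872463466885240942993680121152166093555052553541869431898612667885927980415664148345327615923243195087496157688611201439721890053239563260848609261579708912818619935642507460131258484129392792299741014486826924104771798220477959168173548222789847966259788371346511528267068325433762887144735535789543700809454110136173416155144384659017494135153406162513045538521630198837633600513966687908914166456267933204627637462046837711485440124325712856943472245677217885495254888648892755579388297059123403230265214632674507964199927145373131473236914502166824240893570297052205083101729564448294385157157368162134468390868866365938552756868774060113440681107357433427006914401343110438032755145323322723136328581404110560598343072200961825548180897459157067592248775804007520830774356780711530070013085921581523198179890599314773936925424889875831159463248017081215763562805710783820890353161984550978973352360355532426849817770057866168046012775147653312985966825107965424623026780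7671086224026885120813431625657202639760929896994101389429230517248051699509373798843942874514970066420945145483464135287446218796093841861309563082008709137456120868242031648280703027158960278707458044892947243221483875135227394120875494968496751758708196874562257660305158263546043942909558225727455625049261458064344376440033603),
  (263, 3496474262167245899081652785868191476093155601275242115808335543791912217837051070636877769432647381761577771527591815098997339826852007985143640179644286694471559930269721693289779473789393455857420324312487262233944945734006721481647590801890232409341520710438496929260561253105476316156673799721019388727493002959669958824633224944123005978965004881084755341811876810211450916257381324480721472861142697675767794023958725613345773241486310598358721904667311696859405222848),
  (67, 116197180354549417115556409781592085573843890921355746822381739644479571000616440031384305610396741946438785498274955329),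
  (57, 207788818916006475106260535980330793253865580647283893772935810414548910282805209827995370101825142785),
  (43, 182238902501549434950308979099084178226937856)]

/-- Evaluate the argument first. -/
def force (n : ℕ) (f : ℕ → Bool) : Bool := Nat.rec (f 0) (fun k _ => f (k + 1)) n

theorem force_eq (n : ℕ) (f : ℕ → Bool) : force n f = f n := by cases n <;> rfl

/-- Some guessed model is certified when all pairs with a vertex below `i` are decided. -/
def leaf (M i : ℕ) : Bool :=
  force (Nat.lor M (Nat.shiftLeft (2 ^ 81 - 1) (9 * i))) fun U =>
    tables.any fun q =>
      force (Nat.mod (Nat.shiftRight q.2 (Nat.mul 6 (Nat.mod M q.1))) 64) fun k =>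
        check U (masks.getD k (0, [0]))

/-- Exhaustive search: the pairs lexicographically below `(i, b)` are decided, the labels from `d`
on have not been touched. -/
def srch : ℕ → ℕ → ℕ → ℕ → ℕ → Bool
  | 0, _, _, _, _ => false
  | n + 1, i, b, d, M =>
    bif Nat.ble 9 b then
      (Nat.ble 3 i && leaf M (i + 1)) ||
        (force (i + 1) fun i' => force (i + 2) fun b' =>
          force (bif Nat.ble (i + 2) d then d else i + 2) fun d' => srch n i' b' d' M)
    else
      (force (b + 1) fun b' =>
        (force (Nat.lor M (2 ^ (9 * i + b))) fun M' =>
          ovf M' i || ovf M' b ||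
            (force (bif Nat.ble b' d then d else b') fun d' => srch n i b' d' M')) &&
        (bif Nat.ble b' d then srch n i b' d M else srch n i 9 d M))

theorem srch_true : srch 60 0 1 1 0 = true := by decide +kernel

theorem models_valid : ∀ m ∈ models, m.length = 6 ∧ ∀ s < 6, m.getD s [] ≠ [] ∧
    (∀ u ∈ m.getD s [], u < 9) ∧
    ∀ t < 6, s ≠ t → ∀ u ∈ m.getD s [], u ∉ m.getD t [] := by decide +kernel

theorem blt_iff {a b : ℕ} : Nat.blt a b = true ↔ a < b := by
  rw [Nat.blt_eq]

theorem ble_iff {a b : ℕ} : Nat.ble a b = true ↔ a ≤ b := by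
  rw [Nat.ble_eq]

theorem bit_eq (M k : ℕ) : bit M k = M.testBit k := by
  have h : bit M k = Nat.beq (1 &&& (M >>> k)) 1 := rfl
  rw [h, Nat.testBit, Nat.and_comm, Nat.and_one_is_mod]
  rcases Nat.mod_two_eq_zero_or_one (M >>> k) with h | h <;> (simp [h]; try rfl)

theorem lor_bit (a b k : ℕ) : (Nat.lor a b).testBit k = (a.testBit k || b.testBit k) :=
  Nat.testBit_or a b k

theorem land_bit (a b k : ℕ) : (Nat.land a b).testBit k = (a.testBit k && b.testBit k) :=
  Nat.testBit_and a b k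

theorem line_bit {u k : ℕ} : ∀ {Q : List ℕ}, (line u Q).testBit k = true ↔
    ∃ v ∈ Q, k = code u v
  | [] => by simp [line]
  | v :: Q => by
    have h := @line_bit u k Q
    simp only [line, lor_bit, Bool.or_eq_true, h, Nat.testBit_two_pow, List.mem_cons,
      exists_eq_or_imp, decide_eq_true_eq]
    exact or_congr eq_comm Iff.rfl

theorem cell_bit {k : ℕ} {Q : List ℕ} : ∀ {P : List ℕ}, (cell P Q).testBit k = true ↔
    ∃ u ∈ P, ∃ v ∈ Q, k = code u v
  | [] => by simp [cell]
  | u :: P => by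
    have h := @cell_bit k Q P
    simp only [cell, lor_bit, Bool.or_eq_true, h, line_bit, List.mem_cons, exists_eq_or_imp]

theorem clq_bit {u v : ℕ} : ∀ {P : List ℕ}, u ∈ P → v ∈ P → u ≠ v →
    (clq P).testBit (code u v) = true ∨ (clq P).testBit (code v u) = true
  | [], hu, _, _ => by simp at hu
  | w :: P, hu, hv, huv => by
    simp only [clq, lor_bit, Bool.or_eq_true, line_bit]
    rcases List.mem_cons.1 hu with rfl | hu'
    · rcases List.mem_cons.1 hv with rfl | hv'
      · exact absurd rfl huv
      · exact Or.inl (Or.inl ⟨v, hv', rfl⟩)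
    · rcases List.mem_cons.1 hv with rfl | hv'
      · exact Or.inr (Or.inl ⟨u, hu', rfl⟩)
      · rcases clq_bit hu' hv' huv with h | h
        · exact Or.inl (Or.inr h)
        · exact Or.inr (Or.inr h)

theorem clqs_bit {k : ℕ} {P : List ℕ} : ∀ {R : List (List ℕ)}, P ∈ R →
    (clq P).testBit k = true → (clqs R).testBit k = true
  | [], h, _ => by simp at h
  | S :: R, h, hk => by
    simp only [clqs, lor_bit, Bool.or_eq_true]
    rcases List.mem_cons.1 h with rfl | h
    · exact Or.inl hk
    · exact Or.inr (clqs_bit h hk)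

theorem check_clique {U : ℕ} {m : ℕ × List ℕ} (h : check U m = true) (k : ℕ)
    (hk : m.1.testBit k = true) : U.testBit k = false := by
  simp only [check, Bool.and_eq_true] at h
  have h1 : Nat.land m.1 U = 0 := Nat.eq_of_beq_eq_true h.1
  have h2 := land_bit m.1 U k
  rw [h1, hk] at h2
  simpa using h2.symm

theorem check_cell {U : ℕ} {m : ℕ × List ℕ} (h : check U m = true) (q : ℕ) (hq : q ∈ m.2) :
    ∃ k, q.testBit k = true ∧ U.testBit k = false := by
  simp only [check, Bool.and_eq_true, List.all_eq_true] at h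
  have h1 := h.2 q hq
  by_contra hcon
  push Not at hcon
  have h2 : Nat.land q U = q := by
    apply Nat.eq_of_testBit_eq
    intro k
    rw [land_bit]
    have := hcon k
    cases hqk : q.testBit k <;> simp_all
  rw [h2] at h1
  simp at h1

theorem leaf_bit {M i k : ℕ} (hk : k < 81)
    (h : (Nat.lor M (Nat.shiftLeft (2 ^ 81 - 1) (9 * i))).testBit k = false) :
    M.testBit k = false ∧ k < 9 * i := by
  rw [lor_bit] at h
  have h1 : (Nat.shiftLeft (2 ^ 81 - 1) (9 * i)).testBit k
      = (decide (9 * i ≤ k) && decide (k - 9 * i < 81)) := by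
    rw [← Nat.testBit_two_pow_sub_one]
    exact Nat.testBit_shiftLeft _
  rw [h1] at h
  simp only [Bool.or_eq_false_iff, Bool.and_eq_false_iff, decide_eq_false_iff_not] at h
  refine ⟨h.1, ?_⟩
  omega

theorem code_lt {u v : ℕ} (hu : u < 9) (hv : v < 9) : code u v < 81 := by
  unfold code
  cases h : Nat.blt u v <;> simp <;> omega

theorem code_of_lt {u v : ℕ} (h : u < v) : code u v = 9 * u + v := by
  have : Nat.blt u v = true := blt_iff.2 h
  simp [code, this]

theorem code_of_le {u v : ℕ} (h : v ≤ u) : code u v = 9 * v + u := by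
  have : Nat.blt u v = false := by
    rw [Bool.eq_false_iff]
    intro h'
    have := blt_iff.1 h'
    omega
  simp [code, this]

section Graph

variable {V : Type*} (G : SimpleGraph V) (S : Finset V)

/-- A `K₆⁻` model in `S` all of whose branch sets are cliques. -/
def Mod : Prop := ∃ B : Fin 6 → Set V, (∀ w, (B w).Nonempty) ∧ (∀ w, ∀ u ∈ B w, u ∈ S) ∧
  (∀ s t, s ≠ t → Disjoint (B s) (B t)) ∧
  (∀ w, ∀ u ∈ B w, ∀ v ∈ B w, u ≠ v → G.Adj u v) ∧
  (∀ s t, s < t → ¬(s = 0 ∧ t = 1) → ∃ u ∈ B s, ∃ v ∈ B t, G.Adj u v)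

/-- The invariant of the search. -/
structure Inv (f : ℕ → V) (i b d M : ℕ) : Prop where
  inj : ∀ a c, a < 9 → c < 9 → f a = f c → a = c
  mem : ∀ a, a < 9 → f a ∈ S
  hid : i < d
  hib : i < b
  hbd : b ≤ d ∨ 9 ≤ b
  rec1 : ∀ a c, a < c → c < 9 → M.testBit (9 * a + c) = true → c < d ∧ ¬G.Adj (f a) (f c)
  rec2 : ∀ a c, a < c → c < 9 → (a < i ∨ (a = i ∧ c < b)) → ¬G.Adj (f a) (f c) →
    M.testBit (9 * a + c) = true

theorem models_masks {k : ℕ} (hk : k < 63) : ∃ A B C D E F,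
    masks.getD k (0, [0]) = toMasks [A, B, C, D, E, F] ∧ [A, B, C, D, E, F] ∈ models := by
  have hl : models.length = 63 := by decide +kernel
  have hm : models[k]'(by omega) ∈ models := List.getElem_mem _
  have hlen := (models_valid _ hm).1
  have he : masks.getD k (0, [0]) = toMasks (models[k]'(by omega)) := by
    rw [masks_eq, List.getD_eq_getElem _ _ (by simpa [hl] using hk)]
    simp
  match hh : models[k]'(by omega), hlen with
  | [A, B, C, D, E, F], _ =>
    exact ⟨A, B, C, D, E, F, by rw [he, hh], by rw [← hh]; exact hm⟩

theorem leaf_sound {f : ℕ → V} {i b d M : ℕ} (hI : Inv G S f i b d M) (hb : 9 ≤ b)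
    (h : leaf M (i + 1) = true) : Mod G S := by
  simp only [leaf, force_eq, List.any_eq_true] at h
  obtain ⟨q, -, hq⟩ := h
  generalize Nat.mod (Nat.shiftRight q.2 (Nat.mul 6 (Nat.mod M q.1))) 64 = k at hq
  by_cases hk : k < 63
  swap
  · have hl : masks.length = 63 := by decide +kernel
    rw [List.getD_eq_default _ _ (by omega)] at hq
    obtain ⟨k, hk, -⟩ := check_cell hq 0 (by simp)
    simp at hk
  obtain ⟨A, B, C, D, E, F, he, hm⟩ := models_masks hk
  rw [he] at hq
  -- known adjacency
  have key : ∀ u v, u < 9 → v < 9 → u ≠ v →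
      (Nat.lor M (Nat.shiftLeft (2 ^ 81 - 1) (9 * (i + 1)))).testBit (code u v) = false →
      G.Adj (f u) (f v) := by
    have key' : ∀ u v, u < v → v < 9 →
        (Nat.lor M (Nat.shiftLeft (2 ^ 81 - 1) (9 * (i + 1)))).testBit (9 * u + v) = false →
        G.Adj (f u) (f v) := by
      intro u v huv hv hbit
      obtain ⟨h1, h2⟩ := leaf_bit (by omega) hbit
      by_contra hn
      have := hI.rec2 u v huv hv (by omega) hn
      simp [this] at h1
    intro u v hu hv huv hbit
    rcases lt_or_gt_of_ne huv with hlt | hlt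
    · rw [code_of_lt hlt] at hbit
      exact key' u v hlt hv hbit
    · rw [code_of_le hlt.le] at hbit
      exact (key' v u hlt hu hbit).symm
  obtain ⟨-, hval⟩ := models_valid _ hm
  have hcl : ∀ P ∈ [A, B, C, D, E, F], (∀ u ∈ P, u < 9) → ∀ u ∈ P, ∀ v ∈ P, u ≠ v →
      G.Adj (f u) (f v) := by
    intro P hP hlt u hu v hv huv
    rcases clq_bit hu hv huv with h | h
    · exact key u v (hlt u hu) (hlt v hv) huv (check_clique hq _ (clqs_bit hP h))
    · exact (key v u (hlt v hv) (hlt u hu) huv.symm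
        (check_clique hq _ (clqs_bit hP h))).symm
  have hce : ∀ P Q, cell P Q ∈ (toMasks [A, B, C, D, E, F]).2 → (∀ u ∈ P, u < 9) →
      (∀ u ∈ Q, u < 9) → (∀ u ∈ P, u ∉ Q) → ∃ u ∈ P, ∃ v ∈ Q, G.Adj (f u) (f v) := by
    intro P Q hc hP hQ hd
    obtain ⟨k, hk1, hk2⟩ := check_cell hq _ hc
    obtain ⟨u, hu, v, hv, rfl⟩ := cell_bit.1 hk1
    exact ⟨u, hu, v, hv, key u v (hP u hu) (hQ v hv) (fun h => hd u hu (h ▸ hv)) hk2⟩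
  let p : Fin 6 → List ℕ := fun w => [A, B, C, D, E, F].getD w []
  have hp : ∀ w, p w ∈ [A, B, C, D, E, F] := by
    intro w
    fin_cases w <;> simp [p]
  have hlt : ∀ w, ∀ u ∈ p w, u < 9 := fun w => (hval w w.2).2.1
  have hdis : ∀ s t, s ≠ t → ∀ u ∈ p s, u ∉ p t := fun s t hst =>
    (hval s s.2).2.2 t t.2 (fun h => hst (Fin.ext h))
  refine ⟨fun w => Set.image f {u | u ∈ p w}, ?_, ?_, ?_, ?_, ?_⟩
  · intro w
    obtain ⟨u, hu⟩ := List.exists_mem_of_ne_nil _ (hval w w.2).1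
    exact ⟨f u, u, hu, rfl⟩
  · rintro w _ ⟨u, hu, rfl⟩
    exact hI.mem u (hlt w u hu)
  · intro s t hst
    rw [Set.disjoint_left]
    rintro _ ⟨u, hu, rfl⟩ ⟨v, hv, hvu⟩
    have := hI.inj v u (hlt t v hv) (hlt s u hu) hvu
    subst this
    exact hdis s t hst v hu hv
  · rintro w _ ⟨u, hu, rfl⟩ _ ⟨v, hv, rfl⟩ huv
    exact hcl (p w) (hp w) (hlt w) u hu v hv (fun h => huv (h ▸ rfl))
  · intro s t hst hne
    have hmem : cell (p s) (p t) ∈ (toMasks [A, B, C, D, E, F]).2 := by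
      fin_cases s <;> fin_cases t <;> simp [p, toMasks, cells] at hst hne ⊢
    obtain ⟨u, hu, v, hv, huv⟩ := hce _ _ hmem (hlt s) (hlt t) (hdis s t hst.ne)
    exact ⟨f u, ⟨u, hu, rfl⟩, f v, ⟨v, hv, rfl⟩, huv⟩

variable [DecidableEq V] [DecidableRel G.Adj]

theorem ovf_sound {f : ℕ → V} {i b d M : ℕ} (hI : Inv G S f i b d M)
    (hS : ∀ v ∈ S, (S.filter fun w => w ≠ v ∧ ¬G.Adj v w).card ≤ 3) (a : ℕ) (ha : a < 9) :
    ovf M a = false := by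
  rw [Bool.eq_false_iff]
  intro h
  have h4 : 4 ≤ ((List.range 9).filter (non M a)).length := Nat.le_of_ble_eq_true h
  have hnd : ((List.range 9).filter (non M a)).Nodup := List.nodup_range.filter _
  have hsub : (((List.range 9).filter (non M a)).toFinset.image f) ⊆
      S.filter fun w => w ≠ f a ∧ ¬G.Adj (f a) w := by
    intro w hw
    simp only [Finset.mem_image, List.mem_toFinset, List.mem_filter, List.mem_range] at hw
    obtain ⟨c, ⟨hc, hn⟩, rfl⟩ := hw
    simp only [Finset.mem_filter]
    have hac : a ≠ c ∧ ¬G.Adj (f a) (f c) := by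
      unfold non at hn
      cases h1 : Nat.blt a c
      · rw [h1] at hn
        simp only [cond_false, Bool.and_eq_true, blt_iff] at hn
        obtain ⟨h2, h3⟩ := hn
        rw [bit_eq] at h3
        have := (hI.rec1 c a h2 ha h3).2
        exact ⟨by omega, fun h => this h.symm⟩
      · rw [h1] at hn
        simp only [cond_true] at hn
        rw [blt_iff] at h1
        rw [bit_eq] at hn
        exact ⟨by omega, (hI.rec1 a c h1 hc hn).2⟩
    exact ⟨hI.mem c hc, fun h => hac.1 (hI.inj c a hc ha h).symm, hac.2⟩
  have hcard := Finset.card_le_card hsub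
  rw [Finset.card_image_of_injOn, List.toFinset_card_of_nodup hnd] at hcard
  · have := hS (f a) (hI.mem a ha)
    omega
  · intro c hc c' hc' hcc
    simp only [Finset.mem_coe, List.mem_toFinset, List.mem_filter, List.mem_range] at hc hc'
    exact hI.inj c c' hc.1 hc'.1 hcc

theorem max_eq (m d : ℕ) : (bif Nat.ble m d then d else m) = max d m := by
  cases h : Nat.ble m d
  · have : ¬ m ≤ d := fun h' => by simp [ble_iff.2 h'] at h
    simp; omega
  · have := Nat.le_of_ble_eq_true h
    simp; omega

theorem set_bit {M i b a c : ℕ} (hc : c < 9) (hb : b < 9) :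
    (Nat.lor M (2 ^ (9 * i + b))).testBit (9 * a + c) = true ↔
      M.testBit (9 * a + c) = true ∨ (a = i ∧ c = b) := by
  rw [lor_bit, Nat.testBit_two_pow]
  simp only [Bool.or_eq_true, decide_eq_true_eq]
  refine or_congr Iff.rfl ⟨fun h => by omega, fun h => by omega⟩

theorem inv_set {f : ℕ → V} {i b d M : ℕ} (hI : Inv G S f i b d M) (hb : b < 9)
    (hn : ¬G.Adj (f i) (f b)) :
    Inv G S f i (b + 1) (max d (b + 1)) (Nat.lor M (2 ^ (9 * i + b))) where
  inj := hI.inj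
  mem := hI.mem
  hid := by have := hI.hid; omega
  hib := by have := hI.hib; omega
  hbd := by have := hI.hbd; omega
  rec1 := by
    intro a c hac hc h
    rcases (set_bit hc hb).1 h with h | ⟨rfl, rfl⟩
    · have := hI.rec1 a c hac hc h
      exact ⟨by omega, this.2⟩
    · exact ⟨by omega, hn⟩
  rec2 := by
    intro a c hac hc hk h
    rw [set_bit hc hb]
    by_cases hcb : a = i ∧ c = b
    · exact Or.inr hcb
    · exact Or.inl (hI.rec2 a c hac hc (by omega) h)

theorem inv_swap {f : ℕ → V} {i b d M c : ℕ} (hI : Inv G S f i b d M) (hb : b < 9)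
    (hdb : d ≤ b) (hbc : b ≤ c) (hc : c < 9) :
    Inv G S (fun a => f (Equiv.swap b c a)) i b d M := by
  have hlt : ∀ a, a < 9 → Equiv.swap b c a < 9 := by
    intro a ha
    rw [Equiv.swap_apply_def]
    split_ifs <;> omega
  have hfix : ∀ a, a < b → Equiv.swap b c a = a := by
    intro a ha
    exact Equiv.swap_apply_of_ne_of_ne (by omega) (by omega)
  have hge : ∀ a, b ≤ a → b ≤ Equiv.swap b c a := by
    intro a ha
    rw [Equiv.swap_apply_def]
    split_ifs <;> omega
  have hib := hI.hib
  refine ⟨?_, ?_, hI.hid, hI.hib, hI.hbd, ?_, ?_⟩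
  · intro a a' ha ha' h
    exact (Equiv.swap b c).injective (hI.inj _ _ (hlt a ha) (hlt a' ha') h)
  · intro a ha
    exact hI.mem _ (hlt a ha)
  · intro a e hae he h
    have h1 := hI.rec1 a e hae he h
    refine ⟨h1.1, ?_⟩
    simp only [hfix a (by omega), hfix e (by omega)]
    exact h1.2
  · intro a e hae he hk h
    simp only [hfix a (by omega)] at h
    by_cases heb : e < b
    · rw [hfix e heb] at h
      exact hI.rec2 a e hae he hk h
    · have h1 := hge e (by omega)
      have h2 := hI.rec2 a _ (by omega) (hlt e he) (by omega) h
      have h3 := (hI.rec1 a _ (by omega) (hlt e he) h2).1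
      omega

theorem srch_sound (hS : ∀ v ∈ S, (S.filter fun w => w ≠ v ∧ ¬G.Adj v w).card ≤ 3) :
    ∀ (n i b d M : ℕ) (f : ℕ → V), Inv G S f i b d M → srch n i b d M = true → Mod G S
  | 0, _, _, _, _, _, _, h => by simp [srch] at h
  | n + 1, i, b, d, M, f, hI, h => by
    have ih := srch_sound hS n
    have hib := hI.hib
    have hid := hI.hid
    have hbd := hI.hbd
    simp only [srch, force_eq, max_eq] at h
    by_cases hb : 9 ≤ b
    · rw [ble_iff.2 hb, cond_true, Bool.or_eq_true, Bool.and_eq_true] at h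
      rcases h with h | h
      · exact leaf_sound G S hI hb h.2
      · refine ih _ _ _ _ f ⟨hI.inj, hI.mem, by omega, by omega, by omega, ?_, ?_⟩ h
        · intro a c hac hc hbit
          have := hI.rec1 a c hac hc hbit
          exact ⟨by omega, this.2⟩
        · intro a c hac hc hk hn
          exact hI.rec2 a c hac hc (by omega) hn
    · have hb0 : Nat.ble 9 b = false := by
        rw [Bool.eq_false_iff, Ne, ble_iff]
        exact hb
      have hb9 : b < 9 := by omega
      rw [hb0, cond_false, Bool.and_eq_true] at h
      obtain ⟨h1, h2⟩ := h
      -- the branch where the pair is not adjacent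
      have hset : ∀ g : ℕ → V, Inv G S g i b d M → ¬G.Adj (g i) (g b) → Mod G S := by
        intro g hg hn
        have hg' := inv_set G S hg hb9 hn
        rw [ovf_sound G S hg' hS i (by omega), ovf_sound G S hg' hS b hb9] at h1
        exact ih _ _ _ _ g hg' (by simpa using h1)
      by_cases hbd' : b + 1 ≤ d
      · rw [ble_iff.2 hbd', cond_true] at h2
        by_cases hn : G.Adj (f i) (f b)
        · refine ih _ _ _ _ f ⟨hI.inj, hI.mem, hid, by omega, by omega, hI.rec1, ?_⟩ h2
          intro a c hac hc hk hna
          by_cases hcb : a = i ∧ c = b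
          · rw [hcb.1, hcb.2] at hna
            exact absurd hn hna
          · exact hI.rec2 a c hac hc (by omega) hna
        · exact hset f hI hn
      · have hb1 : Nat.ble (b + 1) d = false := by
          rw [Bool.eq_false_iff, Ne, ble_iff]
          exact hbd'
        rw [hb1, cond_false] at h2
        by_cases hex : ∃ c, b ≤ c ∧ c < 9 ∧ ¬G.Adj (f i) (f c)
        · obtain ⟨c, hbc, hc, hn⟩ := hex
          refine hset _ (inv_swap G S hI hb9 (by omega) hbc hc) ?_
          have : Equiv.swap b c i = i := Equiv.swap_apply_of_ne_of_ne (by omega) (by omega)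
          simp only [this, Equiv.swap_apply_left]
          exact hn
        · push Not at hex
          refine ih _ _ _ _ f ⟨hI.inj, hI.mem, hid, by omega, by omega, hI.rec1, ?_⟩ h2
          intro a c hac hc hk hna
          by_cases hcb : a = i ∧ b ≤ c
          · rw [hcb.1] at hna
            exact absurd (hex c hcb.2 hc) hna
          · exact hI.rec2 a c hac hc (by omega) hna

theorem mod_of_nine (hcard : S.card = 9)
    (hS : ∀ v ∈ S, (S.filter fun w => w ≠ v ∧ ¬G.Adj v w).card ≤ 3) : Mod G S := by
  let e := S.equivFinOfCardEq hcard
  have hne : ∃ v, v ∈ S := by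
    apply Finset.card_pos.1
    omega
  obtain ⟨v₀, hv₀⟩ := hne
  let f : ℕ → V := fun a => if h : a < 9 then (e.symm ⟨a, h⟩ : V) else v₀
  refine srch_sound G S hS 60 0 1 1 0 f ⟨?_, ?_, by omega, by omega, by omega, ?_, ?_⟩ srch_true
  · intro a c ha hc h
    simp only [f, ha, hc, dif_pos] at h
    have := e.symm.injective (Subtype.ext h)
    simpa using this
  · intro a ha
    simp only [f, ha, dif_pos]
    exact (e.symm ⟨a, ha⟩).2
  · intro a c _ _ h
    simp at h
  · intro a c _ _ h
    omega

end Graph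

end K8aux

theorem six_common {V : Type*} [Fintype V] [DecidableEq V] (G : SimpleGraph V)
    [DecidableRel G.Adj] (hG : G.DoubleCritical 8) {x z : V} (hxz : G.Adj x z) :
    6 ≤ (Finset.univ.filter fun w => G.Adj x w ∧ G.Adj z w).card := by
  classical
  obtain ⟨-, hχ, hdel⟩ := hG
  have hcol : (G.induce ({x, z}ᶜ : Set V)).Colorable 6 :=
    SimpleGraph.chromaticNumber_le_iff_colorable.1 (hdel x z hxz)
  obtain ⟨C⟩ := hcol
  -- extend the colouring to a total function
  let c : V → Fin 6 := fun v => if h : v ∈ ({x, z}ᶜ : Set V) then C ⟨v, h⟩ else 0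
  have hc : ∀ u v, u ≠ x → u ≠ z → v ≠ x → v ≠ z → G.Adj u v → c u ≠ c v := by
    intro u v hux huz hvx hvz huv
    have hu : u ∈ ({x, z}ᶜ : Set V) := by simp [hux, huz]
    have hv : v ∈ ({x, z}ᶜ : Set V) := by simp [hvx, hvz]
    simp only [c, hu, hv, dif_pos]
    exact C.valid (by simpa using huv)
  by_contra hlt
  have hj : ∃ j : Fin 6, ∀ w, G.Adj x w → G.Adj z w → c w ≠ j := by
    by_contra hall
    push Not at hall
    apply hlt
    have hsub : (Finset.univ : Finset (Fin 6)) ⊆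
        (Finset.univ.filter fun w => G.Adj x w ∧ G.Adj z w).image c := by
      intro j _
      obtain ⟨w, h1, h2, h3⟩ := hall j
      exact Finset.mem_image.2 ⟨w, by simp [h1, h2], h3⟩
    have h1 := Finset.card_le_card hsub
    have h2 := Finset.card_image_le (s := Finset.univ.filter fun w => G.Adj x w ∧ G.Adj z w)
      (f := c)
    simp only [Finset.card_univ, Fintype.card_fin] at h1
    omega
  obtain ⟨j, hj⟩ := hj
  let c' : V → Option (Fin 6) := fun v =>
    if v = x then none else if v = z then some j
    else if c v = j ∧ G.Adj z v then none else some (c v)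
  have hval : ∀ u v, G.Adj u v → c' u ≠ c' v := by
    intro u v huv
    have hne := huv.ne
    have hzx := hxz.symm
    simp only [c']
    by_cases hux : u = x
    · subst hux
      have hvu : v ≠ u := hne.symm
      by_cases hvz : v = z
      · simp [hvu, hvz, hxz.ne']
      · have := hj v huv
        simp only [if_true, if_neg hvu, if_neg hvz]
        split_ifs with h
        · exact absurd h.1 (this h.2)
        · simp
    by_cases hvx : v = x
    · subst hvx
      by_cases huz : u = z
      · simp [huz, hxz.ne']
      · have := hj u huv.symm
        simp only [if_true, if_neg hux, if_neg huz]
        split_ifs with h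
        · exact absurd h.1 (this h.2)
        · simp
    by_cases huz : u = z
    · subst huz
      simp only [if_true, if_neg hvx, if_neg hux, if_neg hne.symm]
      split_ifs with h
      · simp
      · intro h'
        exact h ⟨(Option.some.inj h').symm, huv⟩
    by_cases hvz : v = z
    · subst hvz
      simp only [if_true, if_neg hvx, if_neg hux, if_neg huz]
      split_ifs with h
      · simp
      · intro h'
        exact h ⟨Option.some.inj h', huv.symm⟩
    have hcc := hc u v hux huz hvx hvz huv
    simp only [if_neg hvx, if_neg hux, if_neg huz, if_neg hvz]
    split_ifs with h h'
    · exact absurd (h.1.trans h'.1.symm) hcc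
    · simp
    · simp
    · exact fun h' => hcc (Option.some.inj h')
  have h7 : G.Colorable 7 := by
    have := (SimpleGraph.Coloring.mk c' (fun {u v} h => hval u v h)).colorable
    simpa using this
  have h8 := h7.chromaticNumber_le
  rw [hχ] at h8
  have : (8 : ℕ) ≤ 7 := by exact_mod_cast h8
  omega

theorem hasMinor_of_mod {V : Type*} (G : SimpleGraph V) (S : Finset V) {x y : V}
    (hxy : G.Adj x y) (hx : ∀ v ∈ S, G.Adj x v) (hy : ∀ v ∈ S, G.Adj y v)
    (h : K8aux.Mod G S) : G.HasMinor K8minus := by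
  obtain ⟨B, hne, hS, hdis, hcl, hadj⟩ := h
  have hxS : x ∉ S := fun h => (hx x h).ne rfl
  have hyS : y ∉ S := fun h => (hy y h).ne rfl
  let B' : Fin 8 → Set V := fun w => if h : (w : ℕ) < 6 then B ⟨w, h⟩ else if w = 6 then {x} else {y}
  have hB : ∀ w : Fin 8, ∀ h : (w : ℕ) < 6, B' w = B ⟨w, h⟩ := fun w h => by simp [B', h]
  have hB6 : B' 6 = {x} := by simp [B']
  have hB7 : B' 7 = {y} := by simp [B']
  have hcases : ∀ w : Fin 8, (w : ℕ) < 6 ∨ w = 6 ∨ w = 7 := by decide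
  have hsub : ∀ w : Fin 8, (w : ℕ) < 6 → ∀ u ∈ B' w, u ∈ S := by
    intro w h u hu
    rw [hB w h] at hu
    exact hS _ u hu
  have hne' : ∀ w, (B' w).Nonempty := by
    intro w
    rcases hcases w with h | rfl | rfl
    · rw [hB w h]
      exact hne _
    · exact ⟨x, by simp [hB6]⟩
    · exact ⟨y, by simp [hB7]⟩
  have hdisj : ∀ s t : Fin 8, s < t → Disjoint (B' s) (B' t) := by
    intro s t hst
    have hst' : (s : ℕ) < t := hst
    rcases hcases t with h | rfl | rfl
    · rw [hB s (by omega), hB t h]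
      exact hdis _ _ (fun h => by simp at h; omega)
    · rw [hB6, Set.disjoint_singleton_right]
      exact fun h => hxS (hsub s hst' x h)
    · rw [hB7, Set.disjoint_singleton_right]
      rcases hcases s with h | rfl | rfl
      · exact fun h' => hyS (hsub s h y h')
      · rw [hB6]
        exact fun h => hxy.ne' h
      · omega
  have hedge : ∀ s t : Fin 8, s < t → ¬(s = 0 ∧ t = 1) → ∃ u ∈ B' s, ∃ v ∈ B' t, G.Adj u v := by
    intro s t hst hst0
    have hst' : (s : ℕ) < t := hst
    rcases hcases t with h | rfl | rfl
    · have hs : (s : ℕ) < 6 := by omega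
      rw [hB s hs, hB t h]
      refine hadj _ _ hst' ?_
      rintro ⟨h1, h2⟩
      apply hst0
      have h1' : (s : ℕ) = 0 := congrArg Fin.val h1
      have h2' : (t : ℕ) = 1 := congrArg Fin.val h2
      exact ⟨Fin.ext h1', Fin.ext h2'⟩
    · obtain ⟨u, hu⟩ := hne' s
      exact ⟨u, hu, x, by simp [hB6], (hx u (hsub s hst' u hu)).symm⟩
    · rcases hcases s with h | rfl | rfl
      · obtain ⟨u, hu⟩ := hne' s
        exact ⟨u, hu, y, by simp [hB7], (hy u (hsub s h u hu)).symm⟩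
      · exact ⟨x, by simp [hB6], y, by simp [hB7], hxy⟩
      · omega
  refine ⟨B', hne', ?_, ?_, ?_⟩
  · intro s t hst
    rcases lt_or_gt_of_ne hst with h | h
    · exact hdisj s t h
    · exact (hdisj t s h).symm
  · intro w
    have hclique : ∀ u ∈ B' w, ∀ v ∈ B' w, u ≠ v → G.Adj u v := by
      rcases hcases w with h | rfl | rfl
      · rw [hB w h]
        exact hcl _
      · rw [hB6]
        intro u hu v hv huv
        exact absurd (hu.trans hv.symm) huv
      · rw [hB7]
        intro u hu v hv huv
        exact absurd (hu.trans hv.symm) huv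
    haveI : Nonempty (B' w) := (hne' w).to_subtype
    refine SimpleGraph.Connected.mk ?_
    intro u v
    by_cases huv : u = v
    · rw [huv]
    · apply SimpleGraph.Adj.reachable
      simp only [SimpleGraph.comap_adj, Function.Embedding.subtype_apply]
      exact hclique u u.2 v v.2 (fun h => huv (Subtype.ext h))
  · intro s t hst
    simp only [K8minus, SimpleGraph.deleteEdges_adj, SimpleGraph.top_adj,
      Set.mem_singleton_iff] at hst
    obtain ⟨hne, hpair⟩ := hst
    rcases lt_or_gt_of_ne hne with h | h
    · exact hedge s t h (fun h' => hpair (by rw [h'.1, h'.2]))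
    · obtain ⟨u, hu, v, hv, huv⟩ := hedge t s h
        (fun h' => hpair (by rw [h'.1, h'.2]; exact Sym2.eq_swap))
      exact ⟨v, hv, u, hu, huv.symm⟩

/-- If `G` is a double-critical 8-chromatic graph with minimum degree 10 containing a
vertex `x` of degree 10 such that the neighbourhood graph `G_x` has a vertex of degree 9
(in `G_x`), then `G` has a `K₈⁻` minor. -/
theorem double_critical_eight_chromatic_neighborhood_degree_nine_hasMinor_K8minus
    {V : Type*} [Fintype V] [DecidableEq V] (G : SimpleGraph V) [DecidableRel G.Adj]
    (hG : G.DoubleCritical 8) (hδ : G.minDegree = 10)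
    (x : V) (hx : G.degree x = 10)
    (hv : ∃ v : G.neighborSet x, (G.induce (G.neighborSet x)).degree v = 9) :
    G.HasMinor K8minus := by
  obtain ⟨⟨y, hxy⟩, hdeg⟩ := hv
  have hxy' : G.Adj x y := hxy
  let S : Finset V := (G.neighborFinset x).erase y
  have hcard : S.card = 9 := by
    rw [Finset.card_erase_of_mem (by simpa using hxy'), SimpleGraph.card_neighborFinset_eq_degree,
      hx]
  have hxS : ∀ v ∈ S, G.Adj x v := by
    intro v hv
    simpa using (Finset.mem_erase.1 hv).2
  have hyS : ∀ v ∈ S, G.Adj y v := by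
    have hsub : ((G.induce (G.neighborSet x)).neighborFinset ⟨y, hxy⟩).image Subtype.val ⊆ S := by
      intro v hv
      obtain ⟨⟨w, hw⟩, h1, rfl⟩ := Finset.mem_image.1 hv
      rw [SimpleGraph.mem_neighborFinset] at h1
      have h2 : G.Adj y w := h1
      have h3 : G.Adj x w := hw
      exact Finset.mem_erase.2 ⟨h2.ne', by simpa using h3⟩
    have heq := Finset.eq_of_subset_of_card_le hsub (by
      rw [Finset.card_image_of_injective _ Subtype.val_injective,
        SimpleGraph.card_neighborFinset_eq_degree, hdeg, hcard])
    intro v hv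
    rw [← heq] at hv
    obtain ⟨⟨w, hw⟩, h1, rfl⟩ := Finset.mem_image.1 hv
    rw [SimpleGraph.mem_neighborFinset] at h1
    exact h1
  refine hasMinor_of_mod G S hxy' hxS hyS (K8aux.mod_of_nine G S hcard ?_)
  intro v hvS
  have h6 := six_common G hG (hxS v hvS)
  have hsub : (Finset.univ.filter fun w => G.Adj x w ∧ G.Adj v w) ⊆
      insert y (S.filter fun w => G.Adj v w) := by
    intro w hw
    obtain ⟨h1, h2⟩ := (Finset.mem_filter.1 hw).2
    by_cases hwy : w = y
    · simp [hwy]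
    · exact Finset.mem_insert_of_mem (Finset.mem_filter.2
        ⟨Finset.mem_erase.2 ⟨hwy, by simpa using h1⟩, h2⟩)
  have h7 := (Finset.card_le_card hsub).trans (Finset.card_insert_le _ _)
  have hdisj : Disjoint (insert v (S.filter fun w => G.Adj v w))
      (S.filter fun w => w ≠ v ∧ ¬G.Adj v w) := by
    rw [Finset.disjoint_left]
    intro w hw hw'
    have h1 := (Finset.mem_filter.1 hw').2
    rcases Finset.mem_insert.1 hw with h | h
    · exact h1.1 h
    · exact h1.2 (Finset.mem_filter.1 h).2
  have hun : insert v (S.filter fun w => G.Adj v w) ∪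
      (S.filter fun w => w ≠ v ∧ ¬G.Adj v w) ⊆ S := by
    intro w hw
    rcases Finset.mem_union.1 hw with h | h
    · rcases Finset.mem_insert.1 h with h | h
      · rw [h]
        exact hvS
      · exact (Finset.mem_filter.1 h).1
    · exact (Finset.mem_filter.1 h).1
  have h8 := Finset.card_le_card hun
  rw [Finset.card_union_of_disjoint hdisj, Finset.card_insert_of_notMem (by simp), hcard] at h8
  omega
end
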